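/- arXiv:math/0703643 — 3 statements merged into one kernel-verified Lean document; each statement's English description precedes it below -/
import Mathlib

section
/- Let R be a commutative ring, C a semidualizing R-module, and M an R-module admitting an augmented proper P_C-projective resolution. The following are equivalent: (i) for some (equivalently, every) augmented proper P_C-projective resolution X⁺ of M with truncation X, one has H^1(Hom_R(X,N)) = 0 for every R-module N; (ii) for some (equivalently, every) such X, one has H^i(Hom_R(X,N)) = 0 for all i ≥ 1 and every R-module N; (iii) M is C-projective, i.e., M ≅ C ⊗_R P for some projective R-module P. -/
open TensorProduct CategoryTheory

noncomputable section

/-- The natural evaluation map `ν_M : C ⊗_R Hom_R(C,M) → M`, `c ⊗ f ↦ f c`. -/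
def evalNu (R : Type) [CommRing R] (C : Type) [AddCommGroup C] [Module R C]
    (M : Type) [AddCommGroup M] [Module R M] :
    (C ⊗[R] (C →ₗ[R] M)) →ₗ[R] M :=
  TensorProduct.lift LinearMap.applyₗ

/-- The natural map `μ_M : M → Hom_R(C, C ⊗_R M)`, `m ↦ (c ↦ c ⊗ m)`. -/
def muMap (R : Type) [CommRing R] (C : Type) [AddCommGroup C] [Module R C]
    (M : Type) [AddCommGroup M] [Module R M] :
    M →ₗ[R] (C →ₗ[R] (C ⊗[R] M)) :=
  (TensorProduct.mk R C M).flip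

/-- `Ext^i_R(A,B)`. -/
def extMod (R : Type) [CommRing R] (A : Type) [AddCommGroup A] [Module R A]
    (B : Type) [AddCommGroup B] [Module R B] (i : ℕ) : ModuleCat R :=
  ((Ext R (ModuleCat R) i).obj (Opposite.op (ModuleCat.of R A))).obj (ModuleCat.of R B)

/-- `Tor_i^R(A,B)`. -/
def torMod (R : Type) [CommRing R] (A : Type) [AddCommGroup A] [Module R A]
    (B : Type) [AddCommGroup B] [Module R B] (i : ℕ) : ModuleCat R :=
  ((Tor (ModuleCat R) i).obj (ModuleCat.of R A)).obj (ModuleCat.of R B)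

/-- A semidualizing module: `C` admits a degreewise finite projective resolution,
the homothety map `R → Hom_R(C,C)` is bijective, and `Ext^i_R(C,C) = 0` for `i ≥ 1`. -/
def IsSemidualizing (R : Type) [CommRing R] (C : Type) [AddCommGroup C] [Module R C] :
    Prop :=
  (∃ (P : ℕ → ModuleCat.{0} R) (d : ∀ n, ↥(P (n + 1)) →ₗ[R] ↥(P n)) (ε : ↥(P 0) →ₗ[R] C),
      (∀ n, Module.Finite R ↥(P n)) ∧ (∀ n, Module.Projective R ↥(P n)) ∧
      Function.Surjective ε ∧ Function.Exact (d 0) ε ∧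
      ∀ n, Function.Exact (d (n + 1)) (d n)) ∧
  Function.Bijective (fun r : R => (r • LinearMap.id : C →ₗ[R] C)) ∧
  ∀ i : ℕ, 1 ≤ i → Subsingleton (extMod R C C i)

/-- The Bass class `B_C`. -/
def MemBassClass (R : Type) [CommRing R] (C : Type) [AddCommGroup C] [Module R C]
    (M : Type) [AddCommGroup M] [Module R M] : Prop :=
  (∀ i : ℕ, 1 ≤ i → Subsingleton (extMod R C M i)) ∧
  (∀ i : ℕ, 1 ≤ i → Subsingleton (torMod R C (C →ₗ[R] M) i)) ∧
  Function.Bijective (evalNu R C M)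

/-- The Auslander class `A_C`. -/
def MemAuslanderClass (R : Type) [CommRing R] (C : Type) [AddCommGroup C] [Module R C]
    (M : Type) [AddCommGroup M] [Module R M] : Prop :=
  (∀ i : ℕ, 1 ≤ i → Subsingleton (torMod R C M i)) ∧
  (∀ i : ℕ, 1 ≤ i → Subsingleton (extMod R C (C ⊗[R] M) i)) ∧
  Function.Bijective (muMap R C M)

/-- `X⁺ : ⋯ → C ⊗ P₁ → C ⊗ P₀ → M → 0` is an augmented proper `P_C`-projective resolution:
each `Pᵢ` is projective, it is a complex, and `Hom_R(C ⊗ Q, X⁺)` is exact for each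
projective module `Q`. -/
def IsAugProperRes (R : Type) [CommRing R] (C : Type) [AddCommGroup C] [Module R C]
    (M : Type) [AddCommGroup M] [Module R M] (P : ℕ → ModuleCat.{0} R)
    (d : ∀ n : ℕ, (C ⊗[R] ↥(P (n + 1))) →ₗ[R] (C ⊗[R] ↥(P n)))
    (ε : (C ⊗[R] ↥(P 0)) →ₗ[R] M) : Prop :=
  (∀ n, Module.Projective R ↥(P n)) ∧
  (∀ n, (d n).comp (d (n + 1)) = 0) ∧ (ε.comp (d 0) = 0) ∧
  ∀ (Q : Type) [AddCommGroup Q] [Module R Q], Module.Projective R Q →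
    Function.Surjective (fun g : (C ⊗[R] Q) →ₗ[R] (C ⊗[R] ↥(P 0)) => ε.comp g) ∧
    Function.Exact (fun g : (C ⊗[R] Q) →ₗ[R] (C ⊗[R] ↥(P 1)) => (d 0).comp g)
      (fun g : (C ⊗[R] Q) →ₗ[R] (C ⊗[R] ↥(P 0)) => ε.comp g) ∧
    ∀ n : ℕ, Function.Exact
      (fun g : (C ⊗[R] Q) →ₗ[R] (C ⊗[R] ↥(P (n + 2))) => (d (n + 1)).comp g)
      (fun g : (C ⊗[R] Q) →ₗ[R] (C ⊗[R] ↥(P (n + 1))) => (d n).comp g)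

/-- Exactness of the augmented complex `⋯ → C ⊗ P₁ → C ⊗ P₀ → M → 0`. -/
def ResExact (R : Type) [CommRing R] (C : Type) [AddCommGroup C] [Module R C]
    (M : Type) [AddCommGroup M] [Module R M] (P : ℕ → ModuleCat.{0} R)
    (d : ∀ n : ℕ, (C ⊗[R] ↥(P (n + 1))) →ₗ[R] (C ⊗[R] ↥(P n)))
    (ε : (C ⊗[R] ↥(P 0)) →ₗ[R] M) : Prop :=
  Function.Surjective ε ∧ Function.Exact (d 0) ε ∧
    ∀ n : ℕ, Function.Exact (d (n + 1)) (d n)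

/-- Exactness of the augmented complex in all degrees `< n`
(`C ⊗ Pᵢ` in degree `i`, `M` in degree `-1`). -/
def ResExactLT (R : Type) [CommRing R] (C : Type) [AddCommGroup C] [Module R C]
    (M : Type) [AddCommGroup M] [Module R M] (P : ℕ → ModuleCat.{0} R)
    (d : ∀ n : ℕ, (C ⊗[R] ↥(P (n + 1))) →ₗ[R] (C ⊗[R] ↥(P n)))
    (ε : (C ⊗[R] ↥(P 0)) →ₗ[R] M) (n : ℕ) : Prop :=
  Function.Surjective ε ∧ (0 < n → Function.Exact (d 0) ε) ∧
    ∀ i : ℕ, i + 1 < n → Function.Exact (d (i + 1)) (d i)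


/-- An exact sequence `0 → C ⊗ P_n → ⋯ → C ⊗ P_1 → C ⊗ P_0 → M → 0`
with each `P_i` projective (encoded by an `ℕ`-indexed complex which vanishes
in degrees `> n`). -/
def HasBoundedExactCRes (R : Type) [CommRing R] (C : Type) [AddCommGroup C] [Module R C]
    (M : Type) [AddCommGroup M] [Module R M] (n : ℕ) : Prop :=
  ∃ (P : ℕ → ModuleCat.{0} R)
    (d : ∀ i : ℕ, (C ⊗[R] ↥(P (i + 1))) →ₗ[R] (C ⊗[R] ↥(P i)))
    (ε : (C ⊗[R] ↥(P 0)) →ₗ[R] M),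
      (∀ i, Module.Projective R ↥(P i)) ∧ ResExact R C M P d ε ∧
      ∀ i, n < i → Subsingleton (C ⊗[R] ↥(P i))

/-- `M` has finite `P_C`-projective dimension. -/
def HasFinCPd (R : Type) [CommRing R] (C : Type) [AddCommGroup C] [Module R C]
    (M : Type) [AddCommGroup M] [Module R M] : Prop :=
  ∃ n : ℕ, HasBoundedExactCRes R C M n

/-- `M` has projective dimension at most `n`: there is an exact sequence
`0 → Q_n → ⋯ → Q_0 → M → 0` with each `Q_i` projective. -/
def HasProjDimLE (R : Type) [CommRing R] (M : Type) [AddCommGroup M] [Module R M]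
    (n : ℕ) : Prop :=
  ∃ (Q : ℕ → ModuleCat.{0} R) (d : ∀ i : ℕ, ↥(Q (i + 1)) →ₗ[R] ↥(Q i))
    (ε : ↥(Q 0) →ₗ[R] M),
      (∀ i, Module.Projective R ↥(Q i)) ∧ Function.Surjective ε ∧
      Function.Exact (d 0) ε ∧ (∀ i, Function.Exact (d (i + 1)) (d i)) ∧
      ∀ i, n < i → Subsingleton ↥(Q i)

/-- `M` has injective dimension at most `n`: there is an exact sequence
`0 → M → I⁰ → ⋯ → Iⁿ → 0` with each `I^j` injective. -/
def HasInjDimLE (R : Type) [CommRing R] (M : Type) [AddCommGroup M] [Module R M]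
    (n : ℕ) : Prop :=
  ∃ (I : ℕ → ModuleCat.{0} R) (δ : ∀ j : ℕ, ↥(I j) →ₗ[R] ↥(I (j + 1)))
    (ι : M →ₗ[R] ↥(I 0)),
      (∀ j, Module.Injective R ↥(I j)) ∧ Function.Injective ι ∧
      Function.Exact ι (δ 0) ∧ (∀ j, Function.Exact (δ j) (δ (j + 1))) ∧
      ∀ j, n < j → Subsingleton ↥(I j)


lemma exists_finset_support {R : Type} [CommRing R] {N B ι : Type} [AddCommGroup N] [Module R N]
    [AddCommGroup B] [Module R B] [Module.Finite R N] (f : N →ₗ[R] (ι →₀ B)) :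
    ∃ S : Finset ι, ∀ n, ∀ i ∉ S, f n i = 0 := by
  classical
  obtain ⟨G, hG⟩ := (Module.Finite.fg_top : (⊤ : Submodule R N).FG)
  refine ⟨G.biUnion fun n => (f n).support, fun n i hi => ?_⟩
  have hn : n ∈ Submodule.span R (G : Set N) := hG ▸ Submodule.mem_top
  induction hn using Submodule.span_induction with
  | mem x hx =>
    by_contra h
    exact hi (Finset.mem_biUnion.2 ⟨x, hx, Finsupp.mem_support_iff.2 h⟩)
  | zero => simp
  | add x y _ _ hx hy => simp [hx, hy]
  | smul a x _ hx => simp [hx]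

lemma proj_retract {R : Type} [CommRing R] (P : Type) [AddCommGroup P] [Module R P]
    (hP : Module.Projective R P) :
    ∃ (s : P →ₗ[R] (P →₀ R)) (t : (P →₀ R) →ₗ[R] P), t ∘ₗ s = LinearMap.id := by
  obtain ⟨s, hs⟩ := hP.out
  exact ⟨s, Finsupp.linearCombination R id, LinearMap.ext hs⟩

lemma mu_bij_free {R : Type} [CommRing R] {C : Type} [AddCommGroup C] [Module R C]
    [Module.Finite R C]
    (hC : Function.Bijective (fun r : R => (r • LinearMap.id : C →ₗ[R] C))) (ι : Type) :
    Function.Bijective (muMap R C (ι →₀ R)) := by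
  classical
  let e := TensorProduct.finsuppScalarRight R R C ι
  have he : ∀ (x : ι →₀ R) (c : C) (i : ι), e (c ⊗ₜ x) i = x i • c := fun x c i => by
    simp [e]
  constructor
  · rw [injective_iff_map_eq_zero]
    intro x hx
    ext i
    apply hC.1
    ext c
    have h1 : c ⊗ₜ[R] x = 0 := LinearMap.congr_fun hx c
    have := he x c i
    rw [h1] at this
    simpa using this.symm
  · intro φ
    obtain ⟨S, hS⟩ := exists_finset_support (e.toLinearMap ∘ₗ φ)
    choose r hr using fun i => hC.2 (Finsupp.lapply i ∘ₗ e.toLinearMap ∘ₗ φ)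
    have hr' : ∀ i c, r i • c = e (φ c) i := fun i c => LinearMap.congr_fun (hr i) c
    have hr0 : ∀ i, r i ≠ 0 → i ∈ S := by
      intro i hi
      by_contra h
      apply hi
      apply hC.1
      ext c
      simpa [hr'] using hS c i h
    refine ⟨Finsupp.onFinset S r hr0, ?_⟩
    ext c
    apply e.injective
    ext i
    have := he (Finsupp.onFinset S r hr0) c i
    exact this.trans (hr' i c)

lemma mu_bij_proj {R : Type} [CommRing R] {C : Type} [AddCommGroup C] [Module R C]
    [Module.Finite R C]
    (hC : Function.Bijective (fun r : R => (r • LinearMap.id : C →ₗ[R] C)))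
    (P : Type) [AddCommGroup P] [Module R P] (hP : Module.Projective R P) :
    Function.Bijective (muMap R C P) := by
  obtain ⟨s, t, hst⟩ := proj_retract P hP
  have hst' : ∀ x, t (s x) = x := LinearMap.congr_fun hst
  have hb := mu_bij_free hC P
  constructor
  · rw [injective_iff_map_eq_zero]
    intro x hx
    have : muMap R C _ (s x) = 0 := by
      ext c
      have h1 : c ⊗ₜ[R] x = 0 := LinearMap.congr_fun hx c
      have := congrArg (LinearMap.lTensor C s) h1
      simpa [muMap] using this
    have := hb.1 (this.trans (map_zero _).symm)
    rw [← hst' x, this, map_zero]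
  · intro φ
    obtain ⟨y, hy⟩ := hb.2 (LinearMap.lTensor C s ∘ₗ φ)
    refine ⟨t y, ?_⟩
    ext c
    have h1 : c ⊗ₜ[R] y = LinearMap.lTensor C s (φ c) := LinearMap.congr_fun hy c
    have h2 := congrArg (LinearMap.lTensor C t) h1
    rw [← LinearMap.comp_apply, ← LinearMap.lTensor_comp, hst, LinearMap.lTensor_id] at h2
    simpa [muMap] using h2

/-- extension property, from `Ext¹(C,B) = 0`. -/
def ExtProp (R : Type) [CommRing R] (C B : Type) [AddCommGroup C] [Module R C]
    [AddCommGroup B] [Module R B] : Prop :=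
  ∀ (F : Type) [AddCommGroup F] [Module R F] (p : F →ₗ[R] C), Function.Surjective p →
    ∀ f : LinearMap.ker p →ₗ[R] B, ∃ g : F →ₗ[R] B, ∀ k : LinearMap.ker p, g k = f k

lemma extend_proj {R : Type} [CommRing R] {C : Type} [AddCommGroup C] [Module R C]
    (hC : ExtProp R C C) (P : Type) [AddCommGroup P] [Module R P] (hP : Module.Projective R P)
    (F : Type) [AddCommGroup F] [Module R F] (p : F →ₗ[R] C) (hp : Function.Surjective p)
    [Module.Finite R (LinearMap.ker p)] (f : LinearMap.ker p →ₗ[R] (C ⊗[R] P)) :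
    ∃ g : F →ₗ[R] (C ⊗[R] P), ∀ k : LinearMap.ker p, g k = f k := by
  classical
  obtain ⟨s, t, hst⟩ := proj_retract P hP
  let e := TensorProduct.finsuppScalarRight R R C P
  let f' := e.toLinearMap ∘ₗ LinearMap.lTensor C s ∘ₗ f
  obtain ⟨S, hS⟩ := exists_finset_support f'
  choose g hg using fun i => hC F p hp (Finsupp.lapply i ∘ₗ f')
  let G : F →ₗ[R] (P →₀ C) := ∑ i ∈ S, Finsupp.lsingle i ∘ₗ g i
  have hG : ∀ k : LinearMap.ker p, G k = f' k := by
    intro k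
    ext i
    have : G k i = if i ∈ S then g i k else 0 := by
      simp [G, Finsupp.single_apply]
    rw [this]
    split_ifs with h
    · exact hg i k
    · exact (hS k i h).symm
  refine ⟨LinearMap.lTensor C t ∘ₗ e.symm.toLinearMap ∘ₗ G, fun k => ?_⟩
  have : LinearMap.lTensor C t (LinearMap.lTensor C s (f k)) = f k := by
    rw [← LinearMap.comp_apply, ← LinearMap.lTensor_comp, hst, LinearMap.lTensor_id]; rfl
  simpa [hG, f'] using this

lemma extProp_of_res {R : Type} [CommRing R] {C B : Type} [AddCommGroup C] [Module R C]
    [AddCommGroup B] [Module R B]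
    {Q2 Q1 Q0 : Type} [AddCommGroup Q2] [Module R Q2] [AddCommGroup Q1] [Module R Q1]
    [AddCommGroup Q0] [Module R Q0] [Module.Projective R Q0]
    (d1 : Q2 →ₗ[R] Q1) (d0 : Q1 →ₗ[R] Q0) (π : Q0 →ₗ[R] C)
    (hd : d0 ∘ₗ d1 = 0) (hex : Function.Exact d0 π)
    (hB : ∀ u : Q1 →ₗ[R] B, u ∘ₗ d1 = 0 → ∃ h : Q0 →ₗ[R] B, h ∘ₗ d0 = u)
    (hπ : Function.Surjective π) :
    ExtProp R C B := by
  intro F _ _ p hp f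
  obtain ⟨l, hl⟩ := Module.projective_lifting_property p π hp
  have hl' : ∀ q, p (l q) = π q := LinearMap.congr_fun hl
  let l1 : Q1 →ₗ[R] LinearMap.ker p := (l ∘ₗ d0).codRestrict _ (fun q => by
    simp [hl', hex.apply_apply_eq_zero])
  have hl1 : ∀ q, (l1 q : F) = l (d0 q) := fun q => rfl
  obtain ⟨h, hh⟩ := hB (f ∘ₗ l1) (by
    ext q
    have : l1 (d1 q) = 0 := by
      apply Subtype.ext
      rw [hl1, ← LinearMap.comp_apply d0, hd]; simp
    simp [this])
  have hh' : ∀ q, h (d0 q) = f (l1 q) := LinearMap.congr_fun hh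
  let a : (Q0 × LinearMap.ker p) →ₗ[R] F := l.coprod (LinearMap.ker p).subtype
  let b : (Q0 × LinearMap.ker p) →ₗ[R] B := h.coprod f
  have ha : Function.Surjective a := by
    intro x
    obtain ⟨q, hq⟩ := hπ (p x)
    refine ⟨(q, ⟨x - l q, ?_⟩), ?_⟩
    · simp [hl', hq]
    · simp [a]
  have hab : LinearMap.ker a ≤ LinearMap.ker b := by
    rintro ⟨q, k⟩ hqk
    have h1 : l q + (k : F) = 0 := by simpa [a] using hqk
    have h2 : π q = 0 := by
      rw [← hl']
      have := congrArg p h1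
      simpa using this
    obtain ⟨q1, rfl⟩ := (hex q).1 h2
    have h3 : k = - l1 q1 := by
      apply Subtype.ext
      have := hl1 q1
      simp only [Submodule.coe_neg, this]
      exact (neg_eq_of_add_eq_zero_right h1).symm
    simp [b, hh', h3]
  let E := a.quotKerEquivOfSurjective ha
  refine ⟨(LinearMap.ker a).liftQ b hab ∘ₗ E.symm.toLinearMap, fun k => ?_⟩
  have : E.symm (k : F) = Submodule.Quotient.mk (0, k) := by
    rw [LinearEquiv.symm_apply_eq]
    simp [E, a]
  simp only [LinearMap.comp_apply, LinearEquiv.coe_coe, this]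
  erw [Submodule.liftQ_apply]
  simp [b]

lemma extProp_of_ext {R : Type} [CommRing R] {C B : Type} [AddCommGroup C] [Module R C]
    [AddCommGroup B] [Module R B] (h : Subsingleton (extMod R C B 1)) :
    ExtProp R C B := by
  let Q := ProjectiveResolution.of (ModuleCat.of R C)
  have hz : Limits.IsZero (extMod R C B 1) := ModuleCat.isZero_of_subsingleton _
  have hz2 := hz.of_iso (Q.isoExt (R := R) 1 (ModuleCat.of R B)).symm
  rw [← HomologicalComplex.exactAt_iff_isZero_homology,
    HomologicalComplex.exactAt_iff' _ 0 1 2 (by simp) (by simp),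
    ShortComplex.moduleCat_exact_iff] at hz2
  have hp : Module.Projective R (Q.complex.X 0) :=
    (IsProjective.iff_projective _).2 (Q.projective 0)
  have h0 : Function.Exact (Q.complex.d 1 0).hom (Q.π.f 0).hom := by
    have := Q.exact₀
    rw [ShortComplex.ShortExact.moduleCat_exact_iff_function_exact] at this
    exact this
  refine extProp_of_res (Q.complex.d 2 1).hom (Q.complex.d 1 0).hom (Q.π.f 0).hom ?_ h0 ?_ ?_
  · rw [← ModuleCat.hom_comp]; simp
  · intro u hu
    obtain ⟨x, hx⟩ := hz2 (ModuleCat.ofHom u) (by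
      apply ModuleCat.hom_ext
      exact hu)
    exact ⟨x.hom, congrArg ModuleCat.Hom.hom hx⟩
  · have : Epi (Q.π.f 0) := inferInstance
    exact (ModuleCat.epi_iff_surjective _).1 this

lemma descend {R : Type} [CommRing R] {A B D : Type} [AddCommGroup A] [Module R A]
    [AddCommGroup B] [Module R B] [AddCommGroup D] [Module R D]
    (a : A →ₗ[R] D) (ha : Function.Surjective a) (b : A →ₗ[R] B)
    (hab : ∀ x, a x = 0 → b x = 0) : ∃ s : D →ₗ[R] B, ∀ x, s (a x) = b x := by
  have hab' : LinearMap.ker a ≤ LinearMap.ker b := fun x hx => hab x hx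
  let E := a.quotKerEquivOfSurjective ha
  refine ⟨(LinearMap.ker a).liftQ b hab' ∘ₗ E.symm.toLinearMap, fun x => ?_⟩
  have : E.symm (a x) = Submodule.Quotient.mk x := by
    rw [LinearEquiv.symm_apply_eq]
    simp [E]
  simp only [LinearMap.comp_apply, LinearEquiv.coe_coe, this]
  erw [Submodule.liftQ_apply]

/-- A McCoy-type argument: a finitely generated faithful module has a nonzero map to every
nonzero module. -/
lemma exists_hom_ne_zero {R : Type} [CommRing R] {C : Type} [AddCommGroup C] [Module R C]
    [Module.Finite R C] (hC : ∀ r : R, (∀ c : C, r • c = 0) → r = 0)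
    {K : Type} [AddCommGroup K] [Module R K] (x : K) (hx : x ≠ 0) :
    ∃ φ : C →ₗ[R] K, φ ≠ 0 := by
  classical
  obtain ⟨n, q, hq⟩ := Module.Finite.exists_fin' R C
  let Pr : ℕ → Prop := fun r => ∃ (ρ : Fin r → (Fin n → R)) (e : Fin r → Fin n),
    (∀ i, q (ρ i) = 0) ∧ (Matrix.of fun i j => ρ i (e j)).det • x ≠ 0
  have hinj : ∀ r (ρ : Fin r → (Fin n → R)) (e : Fin r → Fin n),
      (Matrix.of fun i j => ρ i (e j)).det • x ≠ 0 → Function.Injective e := by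
    intro r ρ e h i j hij
    by_contra hne
    apply h
    rw [Matrix.det_zero_of_column_eq hne, zero_smul]
    intro k
    simp [hij]
  have h0 : Pr 0 := ⟨fun i => i.elim0, fun i => i.elim0, fun i => i.elim0, by simpa using hx⟩
  have hn : ¬ Pr n := by
    rintro ⟨ρ, e, hρ, hd⟩
    have he := hinj _ _ _ hd
    have hes : Function.Surjective e := Finite.surjective_of_injective he
    apply hd
    set A : Matrix (Fin n) (Fin n) R := Matrix.of fun i j => ρ i (e j) with hA
    let w : Fin n → C := fun j => q (Pi.single (e j) 1)
    have hAw : ∀ i, ∑ j, A i j • w j = 0 := by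
      intro i
      rw [← hρ i]
      have h1 : ρ i = ∑ k, ρ i k • (Pi.single k (1 : R) : Fin n → R) := by
        ext m
        simp [Finset.sum_apply, Pi.single_apply]
      conv_rhs => rw [h1]
      rw [map_sum]
      simp only [map_smul]
      exact (Equiv.ofBijective e ⟨he, hes⟩).sum_comp
        (fun k => ρ i k • q (Pi.single k (1 : R)))
    have hdet : ∀ k, A.det • w k = 0 := by
      intro k
      have h1 : ∑ j, (A.adjugate * A) k j • w j = 0 := by
        simp only [Matrix.mul_apply, Finset.sum_smul, mul_smul]
        rw [Finset.sum_comm]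
        simp only [← Finset.smul_sum, hAw, smul_zero, Finset.sum_const_zero]
      rw [Matrix.adjugate_mul] at h1
      simpa [Matrix.smul_apply, Matrix.one_apply] using h1
    have : A.det = 0 := by
      apply hC
      intro c
      obtain ⟨y, rfl⟩ := hq c
      have h1 : y = ∑ k, y k • (Pi.single k (1 : R) : Fin n → R) := by
        ext m
        simp [Finset.sum_apply, Pi.single_apply]
      rw [h1, map_sum, Finset.smul_sum]
      refine Finset.sum_eq_zero fun k _ => ?_
      obtain ⟨j, rfl⟩ := hes k
      rw [map_smul, smul_comm]
      erw [hdet j]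
      simp
    rw [this, zero_smul]
  have hex : ∃ m, ¬ Pr m := ⟨n, hn⟩
  obtain ⟨r, hr⟩ : ∃ r, Nat.find hex = r + 1 := by
    refine Nat.exists_eq_succ_of_ne_zero fun h => ?_
    exact Nat.find_spec hex (h ▸ h0)
  have hr1 : ¬ Pr (r + 1) := hr ▸ Nat.find_spec hex
  have hr0 : Pr r := not_not.1 (Nat.find_min hex (by omega))
  have hrn : r < n := by
    have := Nat.find_min' hex hn
    omega
  obtain ⟨ρ, e, hρ, hd⟩ := hr0
  obtain ⟨c, hc⟩ : ∃ c, ∀ j, e j ≠ c := by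
    by_contra! h
    have := Fintype.card_le_of_surjective e h
    simp at this
    omega
  let e' : Fin (r + 1) → Fin n := Fin.cons c e
  let m : Fin (r + 1) → (Fin (r + 1) → R) := Fin.cons 0 (fun i j => ρ i (e' j))
  let L0 : (Fin (r + 1) → R) →ₗ[R] R :=
    (Matrix.detRowAlternating (R := R) (n := Fin (r + 1))).toMultilinearMap.toLinearMap m 0
  let L : (Fin n → R) →ₗ[R] K := (LinearMap.toSpanSingleton R K x) ∘ₗ L0 ∘ₗ
    LinearMap.funLeft R R e'
  have hL : ∀ y, L y = (Matrix.of (Fin.cons (fun j => y (e' j))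
      (fun i j => ρ i (e' j)) : Fin (r + 1) → Fin (r + 1) → R)).det • x := by
    intro y
    have : Function.update m 0 (fun j => y (e' j)) =
      (Fin.cons (fun j => y (e' j)) (fun i j => ρ i (e' j)) : Fin (r + 1) → Fin (r + 1) → R) := by
      simp [m]
    rw [← this]
    rfl
  have hL0 : ∀ y, q y = 0 → L y = 0 := by
    intro y hy
    by_contra h
    apply hr1
    refine ⟨Fin.cons y ρ, e', ?_, ?_⟩
    · intro i
      refine Fin.cases ?_ (fun i => ?_) i
      · simpa using hy
      · simpa using hρ i
    · rw [hL] at h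
      convert h using 4
      ext i j
      refine Fin.cases ?_ (fun i => ?_) i <;> simp
  obtain ⟨φ, hφ⟩ := descend q hq L hL0
  refine ⟨φ, fun h => hd ?_⟩
  have h1 := hφ (Pi.single c 1)
  rw [h, hL, Matrix.det_succ_row_zero, Fin.sum_univ_succ] at h1
  rw [Finset.sum_eq_zero] at h1
  · have h2 := h1.symm
    simpa [e', Matrix.submatrix] using h2
  · intro j _
    have : (Pi.single c (1 : R) : Fin n → R) (e j) = 0 := by
      simp [hc j]
    simp [e', this]

lemma nu_bij {R : Type} [CommRing R] {C : Type} [AddCommGroup C] [Module R C]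
    (hC : IsSemidualizing R C) (M : Type) [AddCommGroup M] [Module R M]
    (hH : Module.Projective R (C →ₗ[R] M)) : Function.Bijective (evalNu R C M) := by
  obtain ⟨⟨P, d, p, hfin, hproj, hp, hex, -⟩, hhom, hext⟩ := hC
  have := hfin 0
  have := hfin 1
  have : Module.Finite R C := Module.Finite.of_surjective p hp
  have hE : ExtProp R C C := extProp_of_ext (hext 1 le_rfl)
  have hfaith : ∀ r : R, (∀ c : C, r • c = 0) → r = 0 := by
    intro r hr
    apply hhom.1
    ext c
    simpa using hr c
  have hmu := mu_bij_proj hhom _ hH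
  have hnm : ∀ h : C →ₗ[R] M, evalNu R C M ∘ₗ muMap R C _ h = h := by
    intro h
    ext c
    simp [evalNu, muMap]
  have hinj : ∀ φ : C →ₗ[R] (C ⊗[R] (C →ₗ[R] M)), evalNu R C M ∘ₗ φ = 0 → φ = 0 := by
    intro φ h
    obtain ⟨y, rfl⟩ := hmu.2 φ
    rw [hnm] at h
    rw [h, map_zero]
  have hνinj : Function.Injective (evalNu R C M) := by
    rw [injective_iff_map_eq_zero]
    intro x hx
    by_contra hne
    obtain ⟨φ, hφ⟩ := exists_hom_ne_zero hfaith
      (⟨x, hx⟩ : LinearMap.ker (evalNu R C M)) (fun h => hne (congrArg Subtype.val h))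
    apply hφ
    have := hinj ((LinearMap.ker (evalNu R C M)).subtype ∘ₗ φ) (by
      ext c; simp)
    ext c
    simpa using LinearMap.congr_fun this c
  refine ⟨hνinj, ?_⟩
  rw [← LinearMap.range_eq_top]
  by_contra hne
  obtain ⟨x, hx⟩ : ∃ x, x ∉ LinearMap.range (evalNu R C M) := by
    by_contra! h
    exact hne (eq_top_iff.2 fun y _ => h y)
  let W := M ⧸ LinearMap.range (evalNu R C M)
  let π : M →ₗ[R] W := (LinearMap.range (evalNu R C M)).mkQ
  have hπ : ∀ y, π y = 0 ↔ y ∈ LinearMap.range (evalNu R C M) :=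
    fun y => Submodule.Quotient.mk_eq_zero _
  obtain ⟨φ, hφ⟩ := exists_hom_ne_zero hfaith (π x) (fun h => hx ((hπ x).1 h))
  apply hφ
  -- lift `φ` to `M`
  have hp0 := hproj 0
  obtain ⟨l, hl⟩ := Module.projective_lifting_property π (φ ∘ₗ p)
    (Submodule.mkQ_surjective _)
  have hl' : ∀ y, π (l y) = φ (p y) := LinearMap.congr_fun hl
  have : Module.Finite R (LinearMap.ker p) := by
    rw [LinearMap.exact_iff] at hex
    rw [hex]
    infer_instance
  let ν' := LinearEquiv.ofInjective (evalNu R C M) hνinj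
  let f : LinearMap.ker p →ₗ[R] (C ⊗[R] (C →ₗ[R] M)) := ν'.symm.toLinearMap ∘ₗ
    (l ∘ₗ (LinearMap.ker p).subtype).codRestrict _ (fun k => by
      rw [← hπ]
      have : p k = 0 := k.2
      simp [hl', this])
  have hf : ∀ k, evalNu R C M (f k) = l k := by
    intro k
    have : (ν' (f k) : M) = l k := by simp [f]
    exact this
  obtain ⟨g, hg⟩ := extend_proj hE _ hH _ p hp f
  obtain ⟨h, hh⟩ := descend p hp (l - evalNu R C M ∘ₗ g) (by
    intro y hy
    have := hg ⟨y, hy⟩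
    have h2 := hf ⟨y, hy⟩
    simp only at this h2
    simp [this, h2])
  ext c
  obtain ⟨y, rfl⟩ := hp c
  rw [← hl']
  have h1 := hh y
  have h2 : evalNu R C M (muMap R C _ h (p y)) = h (p y) := LinearMap.congr_fun (hnm h) (p y)
  rw [LinearMap.zero_apply, hπ]
  refine ⟨muMap R C _ h (p y) + g y, ?_⟩
  rw [map_add, h2, h1]
  simp

lemma hom_proj {R : Type} [CommRing R] {C : Type} [AddCommGroup C] [Module R C]
    (hC : IsSemidualizing R C) {M : Type} [AddCommGroup M] [Module R M]
    {P : ℕ → ModuleCat.{0} R}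
    {d : ∀ k : ℕ, (C ⊗[R] ↥(P (k + 1))) →ₗ[R] (C ⊗[R] ↥(P k))}
    {ε : (C ⊗[R] ↥(P 0)) →ₗ[R] M} (hX : IsAugProperRes R C M P d ε)
    (hv : ∀ (N : Type) [AddCommGroup N] [Module R N],
      Function.Exact (fun f : (C ⊗[R] ↥(P 0)) →ₗ[R] N => f.comp (d 0))
              (fun f : (C ⊗[R] ↥(P 1)) →ₗ[R] N => f.comp (d 1))) :
    Module.Projective R (C →ₗ[R] M) := by
  obtain ⟨⟨P', d', p', hfin, -, hp', -⟩, hhom, -⟩ := hC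
  have := hfin 0
  have : Module.Finite R C := Module.Finite.of_surjective p' hp'
  obtain ⟨hproj, hdd, hεd, hpr⟩ := hX
  obtain ⟨hs, hx, -⟩ := hpr R inferInstance
  let e := TensorProduct.rid R C
  have hs' : ∀ h : C →ₗ[R] M, ∃ g : C →ₗ[R] (C ⊗[R] ↥(P 0)), ε ∘ₗ g = h := by
    intro h
    obtain ⟨g, hg⟩ := hs (h ∘ₗ e.toLinearMap)
    refine ⟨g ∘ₗ e.symm.toLinearMap, ?_⟩
    ext c
    have := LinearMap.congr_fun hg (e.symm c)
    simpa using this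
  have hx' : ∀ g : C →ₗ[R] (C ⊗[R] ↥(P 0)), ε ∘ₗ g = 0 →
      ∃ g1 : C →ₗ[R] (C ⊗[R] ↥(P 1)), d 0 ∘ₗ g1 = g := by
    intro g hg
    obtain ⟨g1, hg1⟩ := (hx (g ∘ₗ e.toLinearMap)).1 (by
      simp only [← LinearMap.comp_assoc, hg, LinearMap.zero_comp])
    refine ⟨g1 ∘ₗ e.symm.toLinearMap, ?_⟩
    ext c
    have := LinearMap.congr_fun hg1 (e.symm c)
    simpa using this
  let N := (C ⊗[R] ↥(P 1)) ⧸ LinearMap.range (d 1)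
  let π : (C ⊗[R] ↥(P 1)) →ₗ[R] N := (LinearMap.range (d 1)).mkQ
  have hπ : π ∘ₗ d 1 = 0 := LinearMap.range_mkQ_comp (d 1)
  obtain ⟨f, hf⟩ := (hv N π).1 hπ
  have hf' : ∀ y, f (d 0 y) = π y := LinearMap.congr_fun hf
  obtain ⟨j, hj⟩ := descend π (Submodule.mkQ_surjective _) (d 0) (by
    intro y hy
    obtain ⟨z, rfl⟩ := (Submodule.Quotient.mk_eq_zero _).1 hy
    exact LinearMap.congr_fun (hdd 0) z)
  have hεj : ∀ z, ε (j z) = 0 := by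
    intro z
    obtain ⟨y, rfl⟩ := Submodule.mkQ_surjective _ z
    erw [hj]
    exact LinearMap.congr_fun hεd y
  let E : (C →ₗ[R] (C ⊗[R] ↥(P 0))) →ₗ[R] (C →ₗ[R] M) := ε.compRight R
  have hE : ∀ g, E g = ε ∘ₗ g := fun g => rfl
  let T : (C →ₗ[R] (C ⊗[R] ↥(P 0))) →ₗ[R] (C →ₗ[R] (C ⊗[R] ↥(P 0))) :=
    (LinearMap.id - j ∘ₗ f).compRight R
  have hT : ∀ g c, T g c = g c - j (f (g c)) := fun g c => rfl
  obtain ⟨s, hs2⟩ := descend E hs' T (by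
    intro g hg
    obtain ⟨g1, rfl⟩ := hx' g hg
    ext c
    rw [hT]
    simp [hf', hj])
  have hmu := mu_bij_proj hhom _ (hproj 0)
  have hA : Module.Projective R (C →ₗ[R] (C ⊗[R] ↥(P 0))) :=
    have := hproj 0
    Module.Projective.of_equiv (LinearEquiv.ofBijective _ hmu)
  refine Module.Projective.of_split s E ?_
  ext h c
  obtain ⟨g, rfl⟩ := hs' h
  have := hs2 g
  rw [hE] at this
  simp only [LinearMap.comp_apply, this, hE, hT, LinearMap.id_apply, map_sub, hεj, sub_zero]

lemma cproj_of_vanish {R : Type} [CommRing R] {C : Type} [AddCommGroup C] [Module R C]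
    (hC : IsSemidualizing R C) {M : Type} [AddCommGroup M] [Module R M]
    {P : ℕ → ModuleCat.{0} R}
    {d : ∀ k : ℕ, (C ⊗[R] ↥(P (k + 1))) →ₗ[R] (C ⊗[R] ↥(P k))}
    {ε : (C ⊗[R] ↥(P 0)) →ₗ[R] M} (hX : IsAugProperRes R C M P d ε)
    (hv : ∀ (N : Type) [AddCommGroup N] [Module R N],
      Function.Exact (fun f : (C ⊗[R] ↥(P 0)) →ₗ[R] N => f.comp (d 0))
              (fun f : (C ⊗[R] ↥(P 1)) →ₗ[R] N => f.comp (d 1))) :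
    ∃ P₀ : ModuleCat.{0} R, Module.Projective R ↥P₀ ∧ Nonempty (M ≃ₗ[R] (C ⊗[R] ↥P₀)) :=
  have hH := hom_proj hC hX hv
  ⟨ModuleCat.of R (C →ₗ[R] M), hH,
    ⟨(LinearEquiv.ofBijective (evalNu R C M) (nu_bij hC M hH)).symm⟩⟩

lemma vanish_of_cproj {R : Type} [CommRing R] {C : Type} [AddCommGroup C] [Module R C]
    {M : Type} [AddCommGroup M] [Module R M]
    {P : ℕ → ModuleCat.{0} R}
    {d : ∀ k : ℕ, (C ⊗[R] ↥(P (k + 1))) →ₗ[R] (C ⊗[R] ↥(P k))}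
    {ε : (C ⊗[R] ↥(P 0)) →ₗ[R] M} (hX : IsAugProperRes R C M P d ε)
    (hM : ∃ P₀ : ModuleCat.{0} R, Module.Projective R ↥P₀ ∧ Nonempty (M ≃ₗ[R] (C ⊗[R] ↥P₀)))
    (N : Type) [AddCommGroup N] [Module R N] (j : ℕ) :
    Function.Exact (fun f : (C ⊗[R] ↥(P j)) →ₗ[R] N => f.comp (d j))
              (fun f : (C ⊗[R] ↥(P (j + 1))) →ₗ[R] N => f.comp (d (j + 1))) := by
  obtain ⟨P₀, hP₀, ⟨e⟩⟩ := hM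
  obtain ⟨hproj, hdd, hεd, hpr⟩ := hX
  have key : ∀ j, ∃ (s : (C ⊗[R] ↥(P j)) →ₗ[R] (C ⊗[R] ↥(P (j + 1))))
      (t : (C ⊗[R] ↥(P (j + 1))) →ₗ[R] (C ⊗[R] ↥(P (j + 2)))),
      s ∘ₗ d j + d (j + 1) ∘ₗ t = LinearMap.id := by
    intro j
    induction j with
    | zero =>
      obtain ⟨σ, hσ⟩ := (hpr P₀ hP₀).1 e.symm.toLinearMap
      have hσ' : ε ∘ₗ (σ ∘ₗ e.toLinearMap) = LinearMap.id := by
        ext m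
        have := LinearMap.congr_fun hσ (e m)
        simpa using this
      obtain ⟨s, hs⟩ := ((hpr (P 0) (hproj 0)).2.1
        (LinearMap.id - (σ ∘ₗ e.toLinearMap) ∘ₗ ε)).1 (by
          simp only [LinearMap.comp_sub, ← LinearMap.comp_assoc] at hσ' ⊢
          simp [hσ'])
      obtain ⟨t, ht⟩ := ((hpr (P 1) (hproj 1)).2.2 0 (LinearMap.id - s ∘ₗ d 0)).1 (by
          simp only [LinearMap.comp_sub, ← LinearMap.comp_assoc] at hs ⊢
          rw [hs, LinearMap.sub_comp, LinearMap.comp_assoc (d 0), hεd]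
          simp)
      refine ⟨s, t, ?_⟩
      simp only at ht
      erw [ht]
      abel
    | succ j ih =>
      obtain ⟨s, t, hst⟩ := ih
      obtain ⟨t', ht'⟩ := ((hpr (P (j + 2)) (hproj (j + 2))).2.2 (j + 1)
        (LinearMap.id - t ∘ₗ d (j + 1))).1 (by
          have h1 : d (j + 1) ∘ₗ t = LinearMap.id - s ∘ₗ d j := by
            rw [← hst]; abel
          simp only [LinearMap.comp_sub, ← LinearMap.comp_assoc]
          rw [h1, LinearMap.sub_comp, LinearMap.comp_assoc, hdd]
          simp)
      refine ⟨t, t', ?_⟩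
      simp only at ht'
      erw [ht']
      abel
  obtain ⟨s, t, hst⟩ := key j
  intro f
  constructor
  · intro hf
    simp only at hf
    refine ⟨f ∘ₗ s, ?_⟩
    have : f ∘ₗ (s ∘ₗ d j + d (j + 1) ∘ₗ t) = f := by rw [hst]; rfl
    rw [LinearMap.comp_add, ← LinearMap.comp_assoc _ _ f, ← LinearMap.comp_assoc _ _ f, hf] at this
    simpa using this
  · rintro ⟨g, rfl⟩
    simp [LinearMap.comp_assoc, hdd]

/-- For `M` admitting an augmented proper `P_C`-projective resolution, the following are
equivalent: (i) `Ext¹_{P_C}(M,N) = 0` for all `N`, computed from some (equivalently,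
every) proper resolution; (ii) `Ext^i_{P_C}(M,N) = 0` for all `i ≥ 1` and all `N`,
computed from some (equivalently, every) proper resolution; (iii) `M` is `C`-projective. -/
theorem relExt_vanishing_iff_cProjective
    (R : Type) [CommRing R] (C : Type) [AddCommGroup C] [Module R C]
    (M : Type) [AddCommGroup M] [Module R M] (hC : IsSemidualizing R C)
    (hres : ∃ (P : ℕ → ModuleCat.{0} R)
      (d : ∀ k : ℕ, (C ⊗[R] ↥(P (k + 1))) →ₗ[R] (C ⊗[R] ↥(P k)))
      (ε : (C ⊗[R] ↥(P 0)) →ₗ[R] M), IsAugProperRes R C M P d ε) :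
    ((∃ (P : ℕ → ModuleCat.{0} R)
        (d : ∀ k : ℕ, (C ⊗[R] ↥(P (k + 1))) →ₗ[R] (C ⊗[R] ↥(P k)))
        (ε : (C ⊗[R] ↥(P 0)) →ₗ[R] M), IsAugProperRes R C M P d ε ∧
          ∀ (N : Type) [AddCommGroup N] [Module R N],
            Function.Exact (fun f : (C ⊗[R] ↥(P 0)) →ₗ[R] N => f.comp (d 0))
              (fun f : (C ⊗[R] ↥(P 1)) →ₗ[R] N => f.comp (d 1))) ↔
      (∃ P₀ : ModuleCat.{0} R, Module.Projective R ↥P₀ ∧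
        Nonempty (M ≃ₗ[R] (C ⊗[R] ↥P₀)))) ∧
    ((∀ (P : ℕ → ModuleCat.{0} R)
        (d : ∀ k : ℕ, (C ⊗[R] ↥(P (k + 1))) →ₗ[R] (C ⊗[R] ↥(P k)))
        (ε : (C ⊗[R] ↥(P 0)) →ₗ[R] M), IsAugProperRes R C M P d ε →
          ∀ (N : Type) [AddCommGroup N] [Module R N],
            Function.Exact (fun f : (C ⊗[R] ↥(P 0)) →ₗ[R] N => f.comp (d 0))
              (fun f : (C ⊗[R] ↥(P 1)) →ₗ[R] N => f.comp (d 1))) ↔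
      (∃ P₀ : ModuleCat.{0} R, Module.Projective R ↥P₀ ∧
        Nonempty (M ≃ₗ[R] (C ⊗[R] ↥P₀)))) ∧
    ((∃ (P : ℕ → ModuleCat.{0} R)
        (d : ∀ k : ℕ, (C ⊗[R] ↥(P (k + 1))) →ₗ[R] (C ⊗[R] ↥(P k)))
        (ε : (C ⊗[R] ↥(P 0)) →ₗ[R] M), IsAugProperRes R C M P d ε ∧
          ∀ (N : Type) [AddCommGroup N] [Module R N], ∀ j : ℕ,
            Function.Exact (fun f : (C ⊗[R] ↥(P j)) →ₗ[R] N => f.comp (d j))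
              (fun f : (C ⊗[R] ↥(P (j + 1))) →ₗ[R] N => f.comp (d (j + 1)))) ↔
      (∃ P₀ : ModuleCat.{0} R, Module.Projective R ↥P₀ ∧
        Nonempty (M ≃ₗ[R] (C ⊗[R] ↥P₀)))) ∧
    ((∀ (P : ℕ → ModuleCat.{0} R)
        (d : ∀ k : ℕ, (C ⊗[R] ↥(P (k + 1))) →ₗ[R] (C ⊗[R] ↥(P k)))
        (ε : (C ⊗[R] ↥(P 0)) →ₗ[R] M), IsAugProperRes R C M P d ε →
          ∀ (N : Type) [AddCommGroup N] [Module R N], ∀ j : ℕ,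
            Function.Exact (fun f : (C ⊗[R] ↥(P j)) →ₗ[R] N => f.comp (d j))
              (fun f : (C ⊗[R] ↥(P (j + 1))) →ₗ[R] N => f.comp (d (j + 1)))) ↔
      (∃ P₀ : ModuleCat.{0} R, Module.Projective R ↥P₀ ∧
        Nonempty (M ≃ₗ[R] (C ⊗[R] ↥P₀)))) := by
  refine ⟨⟨?_, ?_⟩, ⟨?_, ?_⟩, ⟨?_, ?_⟩, ⟨?_, ?_⟩⟩
  · rintro ⟨P, d, ε, hX, hv⟩
    exact cproj_of_vanish hC hX hv
  · intro hM
    obtain ⟨P, d, ε, hX⟩ := hres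
    exact ⟨P, d, ε, hX, fun N _ _ => vanish_of_cproj hX hM N 0⟩
  · intro h
    obtain ⟨P, d, ε, hX⟩ := hres
    exact cproj_of_vanish hC hX (h P d ε hX)
  · intro hM P d ε hX N _ _
    exact vanish_of_cproj hX hM N 0
  · rintro ⟨P, d, ε, hX, hv⟩
    exact cproj_of_vanish hC hX (fun N _ _ => hv N 0)
  · intro hM
    obtain ⟨P, d, ε, hX⟩ := hres
    exact ⟨P, d, ε, hX, fun N _ _ j => vanish_of_cproj hX hM N j⟩
  · intro h
    obtain ⟨P, d, ε, hX⟩ := hres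
    exact cproj_of_vanish hC hX (fun N _ _ => h P d ε hX N 0)
  · intro hM P d ε hX N _ _ j
    exact vanish_of_cproj hX hM N j

end
end

section
/- Let R be a commutative ring, C a semidualizing R-module, M an R-module admitting an augmented proper P_C-projective resolution, and n a nonnegative integer. The following are equivalent: (i) for some (equivalently, every) augmented proper P_C-projective resolution X⁺ of M with truncation X, one has H^{n+1}(Hom_R(X,N)) = 0 for every R-module N; (ii) for some (equivalently, every) such X, one has H^i(Hom_R(X,N)) = 0 for all i ≥ n+1 and every R-module N; (iii) there exists an exact sequence 0 → C ⊗_R P_n → ⋯ → C ⊗_R P_0 → M → 0 with each P_i projective (i.e., M has P_C-projective dimension at most n). -/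
open TensorProduct CategoryTheory

noncomputable section

/-- `N` has vanishing `Ext^{i}(C, N)`, `i ≥ 1`, computed with the resolution `F`. -/
def EVan (R : Type) [CommRing R] (F : ℕ → ModuleCat.{0} R) (δ : ∀ n, ↥(F (n + 1)) →ₗ[R] ↥(F n))
    (N : Type) [AddCommGroup N] [Module R N] : Prop :=
  ∀ (i : ℕ) (φ : ↥(F (i + 1)) →ₗ[R] N), φ.comp (δ (i + 1)) = 0 →
    ∃ ψ : ↥(F i) →ₗ[R] N, ψ.comp (δ i) = φ

def cplx (R : Type) [CommRing R] (F : ℕ → ModuleCat.{0} R) (δ : ∀ n, ↥(F (n + 1)) →ₗ[R] ↥(F n))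
    (hex : ∀ n, Function.Exact (δ (n + 1)) (δ n)) : ChainComplex (ModuleCat.{0} R) ℕ :=
  ChainComplex.of F (fun n => ModuleCat.ofHom (δ n)) (fun n => by
      ext x
      exact (hex n).apply_apply_eq_zero x)

lemma cplx_d (R : Type) [CommRing R] (F : ℕ → ModuleCat.{0} R)
    (δ : ∀ n, ↥(F (n + 1)) →ₗ[R] ↥(F n))
    (hex : ∀ n, Function.Exact (δ (n + 1)) (δ n)) (n : ℕ) :
    (cplx R F δ hex).d (n + 1) n = ModuleCat.ofHom (δ n) :=
  ChainComplex.of_d F (fun n => ModuleCat.ofHom (δ n)) n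

lemma exists_projRes (R : Type) [CommRing R] (C : Type) [AddCommGroup C] [Module R C]
    (F : ℕ → ModuleCat.{0} R) (δ : ∀ n, ↥(F (n + 1)) →ₗ[R] ↥(F n)) (ε : ↥(F 0) →ₗ[R] C)
    (hp : ∀ n, Module.Projective R ↥(F n))
    (hs : Function.Surjective ε) (h0 : Function.Exact (δ 0) ε)
    (hex : ∀ n, Function.Exact (δ (n + 1)) (δ n)) :
    ∃ P : ProjectiveResolution (ModuleCat.of R C), P.complex = cplx R F δ hex := by
  have hcomp : (cplx R F δ hex).d 1 0 ≫ ModuleCat.ofHom ε = 0 := by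
    rw [cplx_d]
    ext x
    exact h0.apply_apply_eq_zero x
  obtain ⟨π, hπ⟩ : ∃ π : cplx R F δ hex ⟶
      (ChainComplex.single₀ (ModuleCat.{0} R)).obj (ModuleCat.of R C),
      π.f 0 = (ModuleCat.ofHom ε : ModuleCat.of R (F 0) ⟶ ModuleCat.of R C) :=
    ⟨(ChainComplex.toSingle₀Equiv (cplx R F δ hex) (ModuleCat.of R C)).symm
                  ⟨ModuleCat.ofHom ε, hcomp⟩,
      ChainComplex.toSingle₀Equiv_symm_apply_f_zero _ hcomp⟩
  have e0 : Function.Exact ((cplx R F δ hex).d 1 0).hom (π.f 0).hom := by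
    rw [hπ, cplx_d]
    exact h0
  have es : Function.Surjective (π.f 0).hom := by
    rw [hπ]
    exact hs
  have en : ∀ n, Function.Exact ((cplx R F δ hex).d (n + 2) (n + 1)).hom
      ((cplx R F δ hex).d (n + 1) n).hom := by
    intro n
    rw [cplx_d, cplx_d]
    exact hex n
  refine ⟨{ complex := cplx R F δ hex
            projective := fun n => (IsProjective.iff_projective (R := R) (F n)).1 (hp n)
            π := π
            quasiIso := ⟨fun n => ?_⟩ }, rfl⟩
  cases n with
  | zero =>
    rw [ChainComplex.quasiIsoAt₀_iff, ShortComplex.quasiIso_iff_of_zeros']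
    · constructor
      · apply ModuleCat.shortComplex_exact
        exact e0
      · exact (ModuleCat.epi_iff_surjective _).mpr es
    · exact (cplx R F δ hex).shape _ _ (by simp)
    · rfl
    · rfl
  | succ n =>
    rw [quasiIsoAt_iff_exactAt']
    · rw [HomologicalComplex.exactAt_iff' _ (n + 1 + 1) (n + 1) n (by simp) (by simp)]
      apply ModuleCat.shortComplex_exact
      exact en n
    · exact ChainComplex.exactAt_succ_single_obj _ _

lemma evan_self (R : Type) [CommRing R] (C : Type) [AddCommGroup C] [Module R C]
    (F : ℕ → ModuleCat.{0} R) (δ : ∀ n, ↥(F (n + 1)) →ₗ[R] ↥(F n)) (ε : ↥(F 0) →ₗ[R] C)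
    (hp : ∀ n, Module.Projective R ↥(F n))
    (hs : Function.Surjective ε) (h0 : Function.Exact (δ 0) ε)
    (hex : ∀ n, Function.Exact (δ (n + 1)) (δ n))
    (hE : ∀ i : ℕ, 1 ≤ i → Subsingleton (extMod R C C i)) : EVan R F δ C := by
  obtain ⟨P, hP⟩ := exists_projRes R C F δ ε hp hs h0 hex
  intro i φ hφ
  have h1 := hE (i + 1) (by omega)
  have h2 : Limits.IsZero ((P.complex.linearYonedaObj R (ModuleCat.of R C)).homology (i+1)) :=
    Limits.IsZero.of_iso (ModuleCat.isZero_of_subsingleton (extMod R C C (i+1)))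
      (P.isoExt (R := R) (i+1) (ModuleCat.of R C)).symm
  rw [← HomologicalComplex.exactAt_iff_isZero_homology,
    HomologicalComplex.exactAt_iff' _ i (i + 1) (i + 2) (by simp) (by simp),
    ShortComplex.moduleCat_exact_iff, hP] at h2
  obtain ⟨ψ, hψ⟩ := h2 (ModuleCat.ofHom φ) (by
    have : (cplx R F δ hex).d (i+2) (i+1) ≫
        (ModuleCat.ofHom φ : ModuleCat.of R (F (i + 1)) ⟶ ModuleCat.of R C) = 0 := by
      rw [cplx_d R F δ hex (i + 1)]
      ext x
      exact LinearMap.congr_fun hφ x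
    exact this)
  have hψ' : (cplx R F δ hex).d (i+1) i ≫ ψ = ModuleCat.ofHom φ := hψ
  rw [cplx_d] at hψ'
  exact ⟨ψ.hom, congrArg ModuleCat.Hom.hom hψ'⟩

lemma tors_aux (R : Type) [CommRing R] (N : Type) [AddCommGroup N] [Module R N] (n : ℕ) :
    ∀ (C : Type) [AddCommGroup C] [Module R C] (s : Finset C), s.card ≤ n →
      Submodule.span R (s : Set C) = ⊤ → (∀ f : C →ₗ[R] N, f = 0) →
      ∀ x : N, (∀ r : R, (∀ c : C, r • c = 0) → r • x = 0) → x = 0 := by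
  classical
  induction n with
  | zero =>
    intro C _ _ s hs hspan _ x hx
    have : s = ∅ := by simpa using hs
    subst this
    have h1 : ∀ c : C, c = 0 := by
      intro c
      have : c ∈ (⊤ : Submodule R C) := trivial
      rw [← hspan] at this
      simpa using this
    simpa using hx 1 (fun c => by rw [h1 c, smul_zero])
  | succ n ih =>
    intro C _ _ s hs hspan hhom x hx
    have key : ∀ c ∈ s, ∀ x : N, (∀ r : R, r • c = 0 → r • x = 0) → x = 0 := by
      intro c hc x hx
      let K := LinearMap.range (LinearMap.toSpanSingleton R C c)
      refine ih (C ⧸ K) ((s.erase c).image K.mkQ) ?_ ?_ ?_ x ?_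
      · refine Finset.card_image_le.trans ?_
        rw [Finset.card_erase_of_mem hc]
        omega
      · rw [eq_top_iff]
        have h2 : Submodule.map K.mkQ (Submodule.span R (s : Set C)) = ⊤ := by
          rw [hspan, Submodule.map_top, Submodule.range_mkQ]
        rw [← h2, Submodule.map_span, Submodule.span_le]
        rintro _ ⟨y, hy, rfl⟩
        by_cases hyc : y = c
        · subst hyc
          have : K.mkQ y = 0 := by
            rw [Submodule.mkQ_apply, Submodule.Quotient.mk_eq_zero]
            exact ⟨1, by simp⟩
          rw [this]
          exact Submodule.zero_mem _
        · apply Submodule.subset_span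
          rw [Finset.mem_coe]
          exact Finset.mem_image_of_mem _ (Finset.mem_erase.2 ⟨hyc, hy⟩)
      · intro f
        have := hhom (f.comp K.mkQ)
        apply LinearMap.ext
        intro y
        obtain ⟨y, rfl⟩ := K.mkQ_surjective y
        exact LinearMap.congr_fun this y
      · intro a ha
        have hker : LinearMap.ker (LinearMap.toSpanSingleton R C c) ≤
            LinearMap.ker (LinearMap.toSpanSingleton R N x) := by
          intro r hr
          simp only [LinearMap.mem_ker, LinearMap.toSpanSingleton_apply] at hr ⊢
          exact hx r hr
        let g : K →ₗ[R] N := (Submodule.liftQ _ _ hker).comp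
          (LinearMap.quotKerEquivRange (LinearMap.toSpanSingleton R C c)).symm.toLinearMap
        have hcK : c ∈ K := ⟨1, by simp⟩
        have hg : g ⟨c, hcK⟩ = x := by
          have : (LinearMap.quotKerEquivRange (LinearMap.toSpanSingleton R C c)).symm ⟨c, hcK⟩
              = Submodule.Quotient.mk 1 := by
            rw [LinearEquiv.symm_apply_eq]
            apply Subtype.ext
            exact (one_smul R c).symm
          change (Submodule.liftQ _ _ hker) _ = x
          refine (congrArg _ this).trans ?_
          exact one_smul R x
        have haK : ∀ y : C, (a • LinearMap.id : C →ₗ[R] C) y ∈ K := by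
          intro y
          have := ha (K.mkQ y)
          rw [← map_smul, Submodule.mkQ_apply, Submodule.Quotient.mk_eq_zero] at this
          exact this
        have hf := LinearMap.congr_fun (hhom (g.comp (LinearMap.codRestrict K _ haK))) c
        have h3 : LinearMap.codRestrict K _ haK c = a • (⟨c, hcK⟩ : K) := by
          apply Subtype.ext
          simp
        rw [LinearMap.comp_apply, h3, map_smul, hg] at hf
        exact hf
    have step : ∀ t : Finset C, t ⊆ s → ∀ x : N,
        (∀ r : R, (∀ c ∈ t, r • c = 0) → r • x = 0) → x = 0 := by
      intro t
      induction t using Finset.induction_on with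
      | empty =>
        intro _ x hx
        simpa using hx 1 (by simp)
      | insert c t _ iht =>
        intro hts x hx
        refine iht (fun y hy => hts (Finset.mem_insert_of_mem hy)) x ?_
        intro r hr
        refine key c (hts (Finset.mem_insert_self _ _)) _ ?_
        intro r' hr'
        rw [smul_smul]
        apply hx
        intro y hy
        rcases Finset.mem_insert.1 hy with rfl | hy
        · rw [mul_comm, mul_smul, hr', smul_zero]
        · rw [mul_smul, hr y hy, smul_zero]
    refine step s le_rfl x ?_
    intro r hr
    apply hx
    intro c
    have hc : c ∈ (⊤ : Submodule R C) := trivial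
    rw [← hspan] at hc
    have : Submodule.span R (s : Set C) ≤ LinearMap.ker (r • LinearMap.id : C →ₗ[R] C) := by
      rw [Submodule.span_le]
      intro y hy
      simpa using hr y hy
    simpa using this hc

lemma faithHom (R : Type) [CommRing R] (C : Type) [AddCommGroup C] [Module R C]
    [hfin : Module.Finite R C]
    (hinj : Function.Injective (fun r : R => (r • LinearMap.id : C →ₗ[R] C)))
    (N : Type) [AddCommGroup N] [Module R N] (h : ∀ f : C →ₗ[R] N, f = 0) (x : N) : x = 0 := by
  obtain ⟨s, hs⟩ := hfin.fg_top
  refine tors_aux R N s.card C s le_rfl hs h x ?_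
  intro r hr
  have : r = 0 := hinj (by
    apply LinearMap.ext
    intro c
    simpa using hr c)
  rw [this, zero_smul]

lemma fin_supp (R : Type) [CommRing R] (F : Type) [AddCommGroup F] [Module R F]
    [hfin : Module.Finite R F] (C : Type) [AddCommGroup C] [Module R C] (I : Type)
    (φ : F →ₗ[R] (I →₀ C)) : ∃ s : Finset I, ∀ y, φ y = ∑ x ∈ s, Finsupp.single x (φ y x) := by
  classical
  obtain ⟨t, ht⟩ := hfin.fg_top
  refine ⟨t.biUnion (fun y => (φ y).support), ?_⟩
  set s := t.biUnion (fun y => (φ y).support)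
  have h1 : (⊤ : Submodule R F) ≤ (Finsupp.supported C R (s : Set I)).comap φ := by
    rw [← ht, Submodule.span_le]
    intro y hy
    simp only [SetLike.mem_coe, Submodule.mem_comap, Finsupp.mem_supported]
    intro x hx
    exact Finset.mem_biUnion.2 ⟨y, hy, hx⟩
  intro y
  have h2 : ((φ y).support : Set I) ⊆ s := (Finsupp.mem_supported R _).1 (h1 (x := y) trivial)
  have h3 := Finsupp.sum_of_support_subset (φ y) (s := s) (by exact_mod_cast h2)
    (fun x c => Finsupp.single x c) (by simp)
  rw [← h3, Finsupp.sum_single]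

lemma mu_free (R : Type) [CommRing R] (C : Type) [AddCommGroup C] [Module R C]
    [Module.Finite R C]
    (hb : Function.Bijective (fun r : R => (r • LinearMap.id : C →ₗ[R] C))) (I : Type) :
    Function.Bijective (muMap R C (I →₀ R)) := by
  classical
  let E : C ⊗[R] (I →₀ R) ≃ₗ[R] (I →₀ C) := TensorProduct.finsuppScalarRight R R C I
  have hE : ∀ c (p : I →₀ R) (i : I), E (c ⊗ₜ p) i = p i • c := by
    intro c p i
    simp [E]
  constructor
  · rw [injective_iff_map_eq_zero]
    intro p hp
    ext i
    apply hb.1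
    apply LinearMap.ext
    intro c
    have := LinearMap.congr_fun hp c
    have h2 : E (c ⊗ₜ p) i = 0 := by
      have : c ⊗ₜ[R] p = 0 := this
      rw [this]; simp
    rw [hE] at h2
    simpa using h2
  · intro φ
    obtain ⟨s, hs⟩ := fin_supp R C C I (E.toLinearMap.comp φ)
    choose r hr using fun i : I => hb.2 ((Finsupp.lapply i).comp (E.toLinearMap.comp φ))
    refine ⟨∑ i ∈ s, Finsupp.single i (r i), ?_⟩
    apply LinearMap.ext
    intro c
    apply E.injective
    ext i
    have h1 := LinearMap.congr_fun (hr i) c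
    have h2 := DFunLike.congr_fun (hs c) i
    simp only [LinearMap.comp_apply, LinearEquiv.coe_coe] at h2 
    rw [h2]
    change E (c ⊗ₜ _) i = _
    rw [hE]
    have h1 : r i • c = E (φ c) i := h1
    simp only [Finsupp.finsetSum_apply, Finsupp.single_apply]
    simp only [Finset.sum_ite_eq']
    split_ifs <;> simp [h1]

lemma mu_bij (R : Type) [CommRing R] (C : Type) [AddCommGroup C] [Module R C]
    [Module.Finite R C]
    (hb : Function.Bijective (fun r : R => (r • LinearMap.id : C →ₗ[R] C)))
    (P : Type) [AddCommGroup P] [Module R P] [hP : Module.Projective R P] :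
    Function.Bijective (muMap R C P) := by
  obtain ⟨s, hs⟩ := (Module.projective_def' (R := R) (P := P)).1 hP
  have hb' := mu_free R C hb P
  constructor
  · rw [injective_iff_map_eq_zero]
    intro p hp
    have h1 : muMap R C _ (s p) = 0 := by
      apply LinearMap.ext
      intro c
      have := LinearMap.congr_fun hp c
      have h2 := congrArg (LinearMap.lTensor C s) this
      simpa [muMap] using h2
    have h2 : s p = 0 := hb'.1 (by rw [h1, map_zero])
    have := LinearMap.congr_fun hs p
    rw [LinearMap.comp_apply, h2] at this
    simpa using this.symm
  · intro φ
    obtain ⟨f, hf⟩ := hb'.2 ((LinearMap.lTensor C s).comp φ)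
    refine ⟨Finsupp.linearCombination R id f, ?_⟩
    apply LinearMap.ext
    intro c
    have h1 := congrArg (LinearMap.lTensor C (Finsupp.linearCombination R (id : P → P)))
      (LinearMap.congr_fun hf c)
    rw [LinearMap.comp_apply, ← LinearMap.comp_apply, ← LinearMap.comp_apply (LinearMap.lTensor C _),
      ← LinearMap.lTensor_comp, hs, LinearMap.lTensor_id] at h1
    simpa [muMap] using h1

section EV
variable {R : Type} [CommRing R] {F : ℕ → ModuleCat.{0} R}
  {δ : ∀ n, ↥(F (n + 1)) →ₗ[R] ↥(F n)}

lemma EVan.retract {A B : Type} [AddCommGroup A] [Module R A] [AddCommGroup B] [Module R B]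
    (hB : EVan R F δ B) (i : A →ₗ[R] B) (p : B →ₗ[R] A) (h : p.comp i = LinearMap.id) :
    EVan R F δ A := by
  intro k φ hφ
  obtain ⟨ψ, hψ⟩ := hB k (i.comp φ) (by rw [LinearMap.comp_assoc, hφ, LinearMap.comp_zero])
  refine ⟨p.comp ψ, ?_⟩
  rw [LinearMap.comp_assoc, hψ, ← LinearMap.comp_assoc, h, LinearMap.id_comp]

lemma EVan.of_zero {A : Type} [AddCommGroup A] [Module R A] (h : ∀ x : A, x = 0) :
    EVan R F δ A := by
  intro k φ hφ
  exact ⟨0, by ext x; exact (h _).trans (h _).symm⟩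

lemma EVan.tensor {C : Type} [AddCommGroup C] [Module R C] (hF : ∀ n, Module.Finite R (F n))
    (hC : EVan R F δ C) (P : Type) [AddCommGroup P] [Module R P] [hP : Module.Projective R P] :
    EVan R F δ (C ⊗[R] P) := by
  classical
  obtain ⟨s, hs⟩ := (Module.projective_def' (R := R) (P := P)).1 hP
  have h1 : EVan R F δ (P →₀ C) := by
    intro k φ hφ
    obtain ⟨t, ht⟩ := fin_supp R (F (k + 1)) C P φ
    choose ψ hψ using fun x : P => hC k ((Finsupp.lapply x).comp φ)
      (by rw [LinearMap.comp_assoc, hφ, LinearMap.comp_zero])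
    refine ⟨∑ x ∈ t, (Finsupp.lsingle x).comp (ψ x), ?_⟩
    apply LinearMap.ext
    intro y
    rw [ht y, LinearMap.comp_apply, LinearMap.sum_apply]
    refine Finset.sum_congr rfl fun x _ => ?_
    have := LinearMap.congr_fun (hψ x) y
    simp only [LinearMap.comp_apply] at this ⊢
    rw [this]
    rfl
  have h2 : EVan R F δ (C ⊗[R] (P →₀ R)) :=
    h1.retract (TensorProduct.finsuppScalarRight R R C P).toLinearMap
      (TensorProduct.finsuppScalarRight R R C P).symm.toLinearMap (by ext; simp)
  refine h2.retract (LinearMap.lTensor C s) (LinearMap.lTensor C (Finsupp.linearCombination R id)) ?_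
  rw [← LinearMap.lTensor_comp, hs, LinearMap.lTensor_id]

lemma EVan.lift {A B D : Type} [AddCommGroup A] [Module R A] [AddCommGroup B] [Module R B]
    [AddCommGroup D] [Module R D] (hp : Module.Projective R (F 0))
    {ε : ↥(F 0) →ₗ[R] A} (hs : Function.Surjective ε) (h0 : Function.Exact (δ 0) ε)
    (hex : ∀ n, Function.Exact (δ (n + 1)) (δ n))
    (g : B →ₗ[R] D) (hg : Function.Surjective g) (hE : EVan R F δ (LinearMap.ker g))
    (f : A →ₗ[R] D) : ∃ f' : A →ₗ[R] B, g.comp f' = f := by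
  obtain ⟨h, hh⟩ := Module.projective_lifting_property g (f.comp ε) hg
  have hk : ∀ x, (h.comp (δ 0)) x ∈ LinearMap.ker g := by
    intro x
    have := LinearMap.congr_fun hh (δ 0 x)
    simp only [LinearMap.comp_apply, h0.apply_apply_eq_zero, map_zero] at this
    exact this
  obtain ⟨ψ, hψ⟩ := hE 0 (LinearMap.codRestrict _ _ hk) (by
    ext x
    simp [(hex 0).apply_apply_eq_zero])
  let h' := h - (LinearMap.ker g).subtype.comp ψ
  have hker : LinearMap.ker ε ≤ LinearMap.ker h' := by
    intro x hx
    obtain ⟨y, rfl⟩ := (h0 x).1 hx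
    have := congrArg Subtype.val (LinearMap.congr_fun hψ y)
    simp only [LinearMap.comp_apply] at this
    simp [h', this]
  refine ⟨(Submodule.liftQ _ h' hker).comp (ε.quotKerEquivOfSurjective hs).symm.toLinearMap, ?_⟩
  apply LinearMap.ext
  intro a
  obtain ⟨x, rfl⟩ := hs a
  have h1 : (ε.quotKerEquivOfSurjective hs).symm (ε x) = Submodule.Quotient.mk x := by
    rw [LinearEquiv.symm_apply_eq]
    rfl
  have h2 := LinearMap.congr_fun hh x
  simp only [LinearMap.comp_apply] at h2
  simp [h1, h', h2]

lemma EVan.quot {B D : Type} [AddCommGroup B] [Module R B]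
    [AddCommGroup D] [Module R D] (hp : ∀ n, Module.Projective R (F n))
    (hex : ∀ n, Function.Exact (δ (n + 1)) (δ n))
    (g : B →ₗ[R] D) (hg : Function.Surjective g) (hE : EVan R F δ (LinearMap.ker g))
    (hB : EVan R F δ B) : EVan R F δ D := by
  intro i φ hφ
  have := hp (i + 1)
  obtain ⟨h, hh⟩ := Module.projective_lifting_property g φ hg
  have hk : ∀ x, (h.comp (δ (i + 1))) x ∈ LinearMap.ker g := by
    intro x
    have := LinearMap.congr_fun hh (δ (i + 1) x)
    have h2 := LinearMap.congr_fun hφ x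
    simp only [LinearMap.comp_apply] at this h2
    rw [h2] at this
    exact this
  obtain ⟨ψ, hψ⟩ := hE (i + 1) (LinearMap.codRestrict _ _ hk) (by
    ext x
    simp [(hex (i + 1)).apply_apply_eq_zero])
  obtain ⟨χ, hχ⟩ := hB i (h - (LinearMap.ker g).subtype.comp ψ) (by
    ext x
    have := congrArg Subtype.val (LinearMap.congr_fun hψ x)
    simp only [LinearMap.comp_apply] at this
    simp [this])
  refine ⟨g.comp χ, ?_⟩
  rw [LinearMap.comp_assoc, hχ]
  ext x
  have := LinearMap.congr_fun hh x
  simp only [LinearMap.comp_apply] at this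
  simp [this]
end EV

/-- Projective dimension at most `n`. -/
def PD (R : Type) [CommRing R] (H : Type) [AddCommGroup H] [Module R H] (n : ℕ) : Prop :=
  HasProjectiveDimensionLT (ModuleCat.of R H) (n + 1)

section PDs
variable {R : Type} [CommRing R]

lemma PD.zero_iff (H : Type) [AddCommGroup H] [Module R H] : PD R H 0 ↔ Module.Projective R H := by
  unfold PD
  rw [zero_add, ← projective_iff_hasProjectiveDimensionLT_one]
  exact (IsProjective.iff_projective (R := R) H).symm

lemma PD.succ_iff {P H : Type} [AddCommGroup H] [Module R H] [AddCommGroup P] [Module R P]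
    (hP : Module.Projective R P) (g : P →ₗ[R] H) (hg : Function.Surjective g) (n : ℕ) :
    PD R H (n + 1) ↔ PD R (LinearMap.ker g) n :=
  (LinearMap.shortExact_shortComplexKer hg).hasProjectiveDimensionLT_X₃_iff n
    ((IsProjective.iff_projective (R := R) P).1 hP)

lemma PD.equiv {H H' : Type} [AddCommGroup H] [Module R H] [AddCommGroup H'] [Module R H']
    (e : H ≃ₗ[R] H') (n : ℕ) (h : PD R H n) : PD R H' n := by
  have : HasProjectiveDimensionLT (ModuleCat.of R H) (n + 1) := h
  exact hasProjectiveDimensionLT_of_iso (LinearEquiv.toModuleIso e) (n + 1)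

lemma PD.mono {H : Type} [AddCommGroup H] [Module R H] {n m : ℕ} (hnm : n ≤ m)
    (h : PD R H n) : PD R H m := by
  have : HasProjectiveDimensionLT (ModuleCat.of R H) (n + 1) := h
  exact hasProjectiveDimensionLT_of_ge _ (n + 1) (m + 1) (by omega)

lemma PD.res_iff (n : ℕ) : ∀ (H : Type) [AddCommGroup H] [Module R H] (P : ℕ → ModuleCat.{0} R)
    (d : ∀ k, ↥(P (k + 1)) →ₗ[R] ↥(P k)) (e : ↥(P 0) →ₗ[R] H),
    (∀ k, Module.Projective R (P k)) → Function.Surjective e → Function.Exact (d 0) e →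
    (∀ k, Function.Exact (d (k + 1)) (d k)) →
    (PD R H n ↔ ∃ r : ↥(P n) →ₗ[R] ↥(P n), r.comp (d n) = d n ∧
      LinearMap.range r ≤ LinearMap.range (d n)) := by
  induction n with
  | zero =>
    intro H _ _ P d e hP hs h0 hex
    rw [PD.zero_iff]
    constructor
    · intro hH
      obtain ⟨s, hs'⟩ := Module.projective_lifting_property e LinearMap.id hs
      refine ⟨LinearMap.id - s.comp e, ?_, ?_⟩
      · ext x
        simp [h0.apply_apply_eq_zero]
      · rintro _ ⟨x, rfl⟩
        refine (h0 _).1 ?_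
        have := LinearMap.congr_fun hs' (e x)
        simp only [LinearMap.comp_apply] at this
        simp [this]
    · rintro ⟨r, hr, hr2⟩
      have hker : LinearMap.ker e ≤ LinearMap.ker (LinearMap.id - r) := by
        intro x hx
        obtain ⟨y, rfl⟩ := (h0 x).1 hx
        have := LinearMap.congr_fun hr y
        simp only [LinearMap.comp_apply] at this
        simp [this]
      have := hP 0
      refine Module.Projective.of_split
        ((Submodule.liftQ _ _ hker).comp (e.quotKerEquivOfSurjective hs).symm.toLinearMap) e ?_
      apply LinearMap.ext
      intro a
      obtain ⟨x, rfl⟩ := hs a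
      have h1 : (e.quotKerEquivOfSurjective hs).symm (e x) = Submodule.Quotient.mk x := by
        rw [LinearEquiv.symm_apply_eq]
        rfl
      have h2 : e (r x) = 0 := (h0 _).2 (hr2 ⟨x, rfl⟩)
      simp [h1, h2]
  | succ n ih =>
    intro H _ _ P d e hP hs h0 hex
    rw [PD.succ_iff (hP 0) e hs n]
    have hc : ∀ x, d 0 x ∈ LinearMap.ker e := fun x => h0.apply_apply_eq_zero x
    refine ih (LinearMap.ker e) (fun k => P (k + 1)) (fun k => d (k + 1))
      (LinearMap.codRestrict _ (d 0) hc) (fun k => hP (k + 1)) ?_ ?_ (fun k => hex (k + 1))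
    · rintro ⟨x, hx⟩
      obtain ⟨y, rfl⟩ := (h0 x).1 hx
      exact ⟨y, rfl⟩
    · intro x
      rw [← hex 0 x]
      exact Subtype.ext_iff
end PDs

section Main
variable {R : Type} [CommRing R] {C : Type} [AddCommGroup C] [Module R C]

/-- The map `P → Hom(C, M)` adjoint to `C ⊗ P → M`. -/
def adjE {P M : Type} [AddCommGroup P] [Module R P] [AddCommGroup M] [Module R M]
    (ε : (C ⊗[R] P) →ₗ[R] M) : P →ₗ[R] (C →ₗ[R] M) :=
  (LinearMap.llcomp R C (C ⊗[R] P) M ε).comp (muMap R C P)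

lemma adjE_apply {P M : Type} [AddCommGroup P] [Module R P] [AddCommGroup M] [Module R M]
    (ε : (C ⊗[R] P) →ₗ[R] M) (p : P) (c : C) : adjE ε p c = ε (c ⊗ₜ p) := rfl

lemma adjE_eq {P M : Type} [AddCommGroup P] [Module R P] [AddCommGroup M] [Module R M]
    (ε : (C ⊗[R] P) →ₗ[R] M) (p : P) : adjE ε p = ε.comp (muMap R C P p) := rfl

lemma adjE_lift {P M : Type} [AddCommGroup P] [Module R P] [AddCommGroup M] [Module R M]
    (e : P →ₗ[R] (C →ₗ[R] M)) : adjE (TensorProduct.lift e.flip) = e := by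
  ext p c
  simp [adjE_apply]

lemma kerEquiv {P M : Type} [AddCommGroup P] [Module R P] [AddCommGroup M] [Module R M]
    (hmu : Function.Bijective (muMap R C P)) (ε : (C ⊗[R] P) →ₗ[R] M) :
    Nonempty (LinearMap.ker (adjE ε) ≃ₗ[R] (C →ₗ[R] LinearMap.ker ε)) := by
  have hm : ∀ (p : LinearMap.ker (adjE ε)) (c : C), muMap R C P p c ∈ LinearMap.ker ε :=
    fun p c => LinearMap.congr_fun p.2 c
  let f : LinearMap.ker (adjE ε) →ₗ[R] (C →ₗ[R] LinearMap.ker ε) :=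
    { toFun := fun p => LinearMap.codRestrict _ (muMap R C P p) (hm p)
      map_add' := by
        intro p q
        ext c
        simp
      map_smul' := by
        intro r p
        ext c
        simp }
  refine ⟨LinearEquiv.ofBijective f ⟨?_, ?_⟩⟩
  · intro p q hpq
    apply Subtype.ext
    apply hmu.1
    ext c
    exact congrArg Subtype.val (LinearMap.congr_fun hpq c)
  · intro g
    obtain ⟨p, hp⟩ := hmu.2 ((LinearMap.ker ε).subtype.comp g)
    refine ⟨⟨p, ?_⟩, ?_⟩
    · rw [LinearMap.mem_ker, adjE_eq, hp]
      ext c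
      simp
    · ext c
      exact LinearMap.congr_fun hp c

lemma hb_zero {P M : Type} [AddCommGroup P] [Module R P] [AddCommGroup M] [Module R M]
    (hP : Module.Projective R P) (ε : (C ⊗[R] P) →ₗ[R] M) (h : Function.Bijective ε) :
    HasBoundedExactCRes R C M 0 := by
  have hsub : Subsingleton (C ⊗[R] PUnit.{1}) := by
    refine ⟨fun a b => ?_⟩
    have : ∀ a : C ⊗[R] PUnit.{1}, a = 0 := by
      intro a
      induction a using TensorProduct.induction_on with
      | zero => rfl
      | tmul x y =>
        have : y = 0 := Subsingleton.elim _ _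
        rw [this, TensorProduct.tmul_zero]
      | add x y hx hy => rw [hx, hy, add_zero]
    rw [this a, this b]
  let P' : ℕ → ModuleCat.{0} R := fun k => match k with
    | 0 => ModuleCat.of R P
    | _ + 1 => ModuleCat.of R PUnit.{1}
  refine ⟨P', fun _ => 0, ε, ?_, ⟨h.2, ?_, ?_⟩, ?_⟩
  · rintro (_ | k)
    · exact hP
    · exact (inferInstance : Module.Projective R PUnit.{1})
  · intro x
    constructor
    · intro hx
      exact ⟨0, (h.1 (hx.trans (map_zero ε).symm)).symm⟩
    · rintro ⟨y, rfl⟩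
      exact map_zero ε
  · intro n x
    refine ⟨fun _ => ⟨0, hsub.elim _ _⟩, fun _ => rfl⟩
  · rintro (_ | k) hk
    · omega
    · exact hsub

lemma hb_succ {P M : Type} [AddCommGroup P] [Module R P] [AddCommGroup M] [Module R M]
    (hP : Module.Projective R P) (ε : (C ⊗[R] P) →ₗ[R] M) (h : Function.Surjective ε) {n : ℕ}
    (hb : HasBoundedExactCRes R C (LinearMap.ker ε) n) :
    HasBoundedExactCRes R C M (n + 1) := by
  obtain ⟨Q, d, η, hQ, ⟨hs, h0, hex⟩, hsub⟩ := hb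
  let P' : ℕ → ModuleCat.{0} R := fun k => match k with
    | 0 => ModuleCat.of R P
    | k + 1 => Q k
  let d' : ∀ k : ℕ, (C ⊗[R] ↥(P' (k + 1))) →ₗ[R] (C ⊗[R] ↥(P' k)) := fun k => match k with
    | 0 => (LinearMap.ker ε).subtype.comp η
    | k + 1 => d k
  refine ⟨P', d', ε, ?_, ⟨h, ?_, ?_⟩, ?_⟩
  · rintro (_ | k)
    · exact hP
    · exact hQ k
  · intro x
    constructor
    · intro hx
      obtain ⟨y, hy⟩ := hs ⟨x, hx⟩
      exact ⟨y, congrArg Subtype.val hy⟩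
    · rintro ⟨y, rfl⟩
      exact (η y).2
  · rintro (_ | k)
    · intro x
      refine Iff.trans ?_ (h0 x)
      exact (Subtype.ext_iff (a1 := η x) (a2 := 0)).symm
    · exact hex k
  · rintro (_ | k) hk
    · omega
    · exact hsub k (by omega)

lemma untensor {P P' : Type} [AddCommGroup P] [Module R P] [AddCommGroup P'] [Module R P']
    (hmu : Function.Bijective (muMap R C P')) (D : (C ⊗[R] P) →ₗ[R] (C ⊗[R] P')) :
    ∃ f : P →ₗ[R] P', LinearMap.lTensor C f = D := by
  refine ⟨(LinearEquiv.ofBijective _ hmu).symm.toLinearMap.comp (adjE D), ?_⟩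
  apply TensorProduct.ext'
  intro c p
  have : muMap R C P' ((LinearEquiv.ofBijective _ hmu).symm (adjE D p)) = adjE D p :=
    (LinearEquiv.ofBijective _ hmu).apply_symm_apply _
  exact LinearMap.congr_fun this c

variable {F : ℕ → ModuleCat.{0} R} {δ : ∀ n, ↥(F (n + 1)) →ₗ[R] ↥(F n)} {η : ↥(F 0) →ₗ[R] C}

lemma pd_of_hb (hp : ∀ n, Module.Projective R (F n)) (hs : Function.Surjective η)
    (h0 : Function.Exact (δ 0) η) (hex : ∀ n, Function.Exact (δ (n + 1)) (δ n))
    (hmu : ∀ (P : Type) [AddCommGroup P] [Module R P], Module.Projective R P →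
      Function.Bijective (muMap R C P))
    (hT : ∀ (P : Type) [AddCommGroup P] [Module R P], Module.Projective R P →
      EVan R F δ (C ⊗[R] P)) (n : ℕ) :
    ∀ (M : Type) [AddCommGroup M] [Module R M], HasBoundedExactCRes R C M n →
      PD R (C →ₗ[R] M) n ∧ EVan R F δ M := by
  induction n with
  | zero =>
    rintro M _ _ ⟨P, d, ε, hP, ⟨es, e0, -⟩, hsub⟩
    have := hsub 1 (by omega)
    have hinj : Function.Injective ε := by
      rw [injective_iff_map_eq_zero]
      intro x hx
      obtain ⟨y, rfl⟩ := (e0 x).1 hx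
      rw [Subsingleton.elim y 0, map_zero]
    let E := LinearEquiv.ofBijective ε ⟨hinj, es⟩
    constructor
    · have h1 : PD R (P 0) 0 := (PD.zero_iff _).2 (hP 0)
      exact h1.equiv ((LinearEquiv.ofBijective _ (hmu (P 0) (hP 0))).trans
        (LinearEquiv.congrRight E))
    · exact (hT (P 0) (hP 0)).retract E.symm.toLinearMap E.toLinearMap (by ext; simp)
  | succ n ih =>
    rintro M _ _ ⟨P, d, ε, hP, ⟨es, e0, een⟩, hsub⟩
    have hc : ∀ x, d 0 x ∈ LinearMap.ker ε := fun x => e0.apply_apply_eq_zero x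
    have hb : HasBoundedExactCRes R C (LinearMap.ker ε) n := by
      refine ⟨fun k => P (k + 1), fun k => d (k + 1), LinearMap.codRestrict _ (d 0) hc,
        fun k => hP (k + 1), ⟨?_, ?_, fun k => een (k + 1)⟩, fun k hk => hsub (k + 1) (by omega)⟩
      · rintro ⟨x, hx⟩
        obtain ⟨y, rfl⟩ := (e0 x).1 hx
        exact ⟨y, rfl⟩
      · intro x
        rw [← een 0 x]
        exact Subtype.ext_iff
    obtain ⟨h1, h2⟩ := ih (LinearMap.ker ε) hb
    constructor
    · obtain ⟨K⟩ := kerEquiv (hmu (P 0) (hP 0)) ε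
      rw [PD.succ_iff (hP 0) (adjE ε)]
      · exact h1.equiv K.symm
      · intro f
        obtain ⟨f', hf'⟩ := EVan.lift (hp 0) hs h0 hex ε es h2 f
        obtain ⟨p, hp⟩ := (hmu (P 0) (hP 0)).2 f'
        exact ⟨p, by rw [adjE_eq, hp, hf']⟩
    · exact EVan.quot hp hex ε es h2 (hT _ (hP 0))

lemma surj_of_ker (hp : ∀ n, Module.Projective R (F n)) (hs : Function.Surjective η)
    (h0 : Function.Exact (δ 0) η) (hex : ∀ n, Function.Exact (δ (n + 1)) (δ n))
    (hT : ∀ (P : Type) [AddCommGroup P] [Module R P], Module.Projective R P →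
      EVan R F δ (C ⊗[R] P))
    (hfaith : ∀ (N : Type) [AddCommGroup N] [Module R N], (∀ f : C →ₗ[R] N, f = 0) →
      ∀ x : N, x = 0)
    {P M : Type} [AddCommGroup P] [Module R P] [AddCommGroup M] [Module R M]
    (hP : Module.Projective R P) (ε : (C ⊗[R] P) →ₗ[R] M) (he : Function.Surjective (adjE ε))
    (hE : EVan R F δ (LinearMap.ker ε)) : Function.Surjective ε := by
  have hB : EVan R F δ (LinearMap.range ε) := by
    refine EVan.quot hp hex ε.rangeRestrict ε.surjective_rangeRestrict ?_ (hT P hP)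
    rw [LinearMap.ker_rangeRestrict]
    exact hE
  have hQ := hfaith (M ⧸ LinearMap.range ε) (by
    intro f
    obtain ⟨f', rfl⟩ := EVan.lift (hp 0) hs h0 hex (LinearMap.range ε).mkQ
      (Submodule.mkQ_surjective _) (by rw [Submodule.ker_mkQ]; exact hB) f
    obtain ⟨p, rfl⟩ := he f'
    ext c
    rw [LinearMap.comp_apply, Submodule.mkQ_apply, LinearMap.zero_apply,
      Submodule.Quotient.mk_eq_zero]
    exact ⟨_, rfl⟩)
  intro m
  have := hQ (Submodule.Quotient.mk m)
  rw [Submodule.Quotient.mk_eq_zero] at this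
  exact this

lemma hb_of_pd (hp : ∀ n, Module.Projective R (F n)) (hs : Function.Surjective η)
    (h0 : Function.Exact (δ 0) η) (hex : ∀ n, Function.Exact (δ (n + 1)) (δ n))
    (hmu : ∀ (P : Type) [AddCommGroup P] [Module R P], Module.Projective R P →
      Function.Bijective (muMap R C P))
    (hT : ∀ (P : Type) [AddCommGroup P] [Module R P], Module.Projective R P →
      EVan R F δ (C ⊗[R] P))
    (hfaith : ∀ (N : Type) [AddCommGroup N] [Module R N], (∀ f : C →ₗ[R] N, f = 0) →
      ∀ x : N, x = 0) (n : ℕ) :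
    ∀ (M : Type) [AddCommGroup M] [Module R M], PD R (C →ₗ[R] M) n →
      HasBoundedExactCRes R C M n ∧ EVan R F δ M := by
  induction n with
  | zero =>
    intro M _ _ hM
    rw [PD.zero_iff] at hM
    let ε : C ⊗[R] (C →ₗ[R] M) →ₗ[R] M := TensorProduct.lift (LinearMap.flip LinearMap.id)
    have hε : adjE ε = LinearMap.id := adjE_lift _
    obtain ⟨K⟩ := kerEquiv (hmu _ hM) ε
    have hz : ∀ x : LinearMap.ker ε, x = 0 := by
      refine hfaith _ fun f => ?_
      have h1 : K.symm f = 0 := by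
        apply Subtype.ext
        have h2 : adjE ε (K.symm f).1 = 0 := (K.symm f).2
        exact (LinearMap.congr_fun hε _).symm.trans h2
      simpa using h1
    have hE : EVan R F δ (LinearMap.ker ε) := EVan.of_zero hz
    have hsurj := surj_of_ker hp hs h0 hex hT hfaith hM ε
      (by rw [hε]; exact Function.surjective_id) hE
    refine ⟨hb_zero hM ε ⟨?_, hsurj⟩, EVan.quot hp hex ε hsurj hE (hT _ hM)⟩
    rw [injective_iff_map_eq_zero]
    intro x hx
    exact congrArg Subtype.val (hz ⟨x, hx⟩)
  | succ n ih =>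
    intro M _ _ hM
    let e : ((C →ₗ[R] M) →₀ R) →ₗ[R] (C →ₗ[R] M) := Finsupp.linearCombination R id
    have he : Function.Surjective e := Finsupp.linearCombination_id_surjective R _
    let ε : C ⊗[R] ((C →ₗ[R] M) →₀ R) →ₗ[R] M := TensorProduct.lift e.flip
    have hε : adjE ε = e := adjE_lift _
    have hPr : Module.Projective R ((C →ₗ[R] M) →₀ R) := inferInstance
    obtain ⟨K⟩ := kerEquiv (hmu _ hPr) ε
    rw [PD.succ_iff hPr (adjE ε) (by rw [hε]; exact he)] at hM
    obtain ⟨hb, hE⟩ := ih _ (hM.equiv K)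
    have hsurj := surj_of_ker hp hs h0 hex hT hfaith hPr ε (by rw [hε]; exact he) hE
    exact ⟨hb_succ hPr ε hsurj hb, EVan.quot hp hex ε hsurj hE (hT _ hPr)⟩

lemma proper_exact (hmu : ∀ (P : Type) [AddCommGroup P] [Module R P], Module.Projective R P →
      Function.Bijective (muMap R C P))
    {M : Type} [AddCommGroup M] [Module R M] {P : ℕ → ModuleCat.{0} R}
    {d : ∀ n : ℕ, (C ⊗[R] ↥(P (n + 1))) →ₗ[R] (C ⊗[R] ↥(P n))}
    {ε : (C ⊗[R] ↥(P 0)) →ₗ[R] M} (h : IsAugProperRes R C M P d ε) :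
    ∃ D : ∀ n, ↥(P (n + 1)) →ₗ[R] ↥(P n), (∀ n, LinearMap.lTensor C (D n) = d n) ∧
      Function.Surjective (adjE ε) ∧ Function.Exact (D 0) (adjE ε) ∧
      ∀ n, Function.Exact (D (n + 1)) (D n) := by
  obtain ⟨hP, hdd, hed, hQ⟩ := h
  obtain ⟨hs, h0, hex⟩ := hQ R inferInstance
  have hmuP := fun k => hmu (P k) (hP k)
  choose D hD using fun k => untensor (hmuP k) (d k)
  let T : C ⊗[R] R ≃ₗ[R] C := TensorProduct.rid R C
  have hDmu : ∀ k p, muMap R C (P k) (D k p) = (d k).comp (muMap R C (P (k + 1)) p) := by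
    intro k p
    rw [← hD k]
    ext c
    simp [muMap]
  have hz : ∀ {A : Type} [AddCommGroup A] [Module R A] (f : C →ₗ[R] A),
      (f.comp T.toLinearMap).comp T.symm.toLinearMap = f := by
    intro A _ _ f
    ext c
    simp
  refine ⟨D, hD, ?_, ?_, ?_⟩
  · intro f
    obtain ⟨g, hg⟩ := hs (f.comp T.toLinearMap)
    obtain ⟨p, hp⟩ := (hmuP 0).2 (g.comp T.symm.toLinearMap)
    refine ⟨p, ?_⟩
    have hg : ε.comp g = f.comp T.toLinearMap := hg
    rw [adjE_eq, hp, ← LinearMap.comp_assoc, hg, hz]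
  · intro x
    constructor
    · intro hx
      rw [adjE_eq] at hx
      obtain ⟨g, hg⟩ := (h0 ((muMap R C _ x).comp T.toLinearMap)).1 (by
        change ε.comp (_) = 0
        rw [← LinearMap.comp_assoc, hx, LinearMap.zero_comp])
      obtain ⟨p, hp⟩ := (hmuP 1).2 (g.comp T.symm.toLinearMap)
      refine ⟨p, (hmuP 0).1 ?_⟩
      have hg : (d 0).comp g = (muMap R C _ x).comp T.toLinearMap := hg
      rw [hDmu, hp, ← LinearMap.comp_assoc, hg, hz]
    · rintro ⟨y, rfl⟩
      rw [adjE_eq, hDmu, ← LinearMap.comp_assoc, hed, LinearMap.zero_comp]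
  · intro n x
    constructor
    · intro hx
      obtain ⟨g, hg⟩ := (hex n ((muMap R C _ x).comp T.toLinearMap)).1 (by
        change (d n).comp (_) = 0
        rw [← LinearMap.comp_assoc, ← hDmu, hx, map_zero, LinearMap.zero_comp])
      obtain ⟨p, hp⟩ := (hmuP (n + 2)).2 (g.comp T.symm.toLinearMap)
      refine ⟨p, (hmuP (n + 1)).1 ?_⟩
      have hg : (d (n + 1)).comp g = (muMap R C _ x).comp T.toLinearMap := hg
      rw [hDmu, hp, ← LinearMap.comp_assoc, hg, hz]
    · rintro ⟨y, rfl⟩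
      apply (hmuP n).1
      rw [hDmu, hDmu, ← LinearMap.comp_assoc, hdd, LinearMap.zero_comp, map_zero]

lemma vanish_of_pd (hmu : ∀ (P : Type) [AddCommGroup P] [Module R P], Module.Projective R P →
      Function.Bijective (muMap R C P))
    {M : Type} [AddCommGroup M] [Module R M] {P : ℕ → ModuleCat.{0} R}
    {d : ∀ n : ℕ, (C ⊗[R] ↥(P (n + 1))) →ₗ[R] (C ⊗[R] ↥(P n))}
    {ε : (C ⊗[R] ↥(P 0)) →ₗ[R] M} (h : IsAugProperRes R C M P d ε) (n : ℕ)
    (hpd : PD R (C →ₗ[R] M) n) (N : Type) [AddCommGroup N] [Module R N] :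
    Function.Exact (fun f : (C ⊗[R] ↥(P n)) →ₗ[R] N => f.comp (d n))
      (fun f : (C ⊗[R] ↥(P (n + 1))) →ₗ[R] N => f.comp (d (n + 1))) := by
  obtain ⟨D, hD, hs, h0, hex⟩ := proper_exact hmu h
  obtain ⟨hP, hdd, hed, hQ⟩ := h
  obtain ⟨r, hr, hr2⟩ := (PD.res_iff n _ P D (adjE ε) hP hs h0 hex).1 hpd
  intro f
  constructor
  · intro hf
    have hf : f.comp (d (n + 1)) = 0 := hf
    have := hP n
    have := hP (n + 1)
    obtain ⟨k, hk⟩ := Module.projective_lifting_property (D n).rangeRestrict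
      (LinearMap.codRestrict _ r (fun x => hr2 ⟨x, rfl⟩)) (D n).surjective_rangeRestrict
    have hk' : ∀ x, D n (k x) = r x := fun x => congrArg Subtype.val (LinearMap.congr_fun hk x)
    have hm : ∀ x, (k.comp (D n) - LinearMap.id : ↥(P (n + 1)) →ₗ[R] ↥(P (n + 1))) x ∈ LinearMap.range (D (n + 1)) := by
      intro x
      refine (hex n _).1 ?_
      have := LinearMap.congr_fun hr x
      simp only [LinearMap.comp_apply] at this
      simp [hk', this]
    obtain ⟨t, ht⟩ := Module.projective_lifting_property (D (n + 1)).rangeRestrict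
      (LinearMap.codRestrict _ _ hm) (D (n + 1)).surjective_rangeRestrict
    have ht' : k.comp (D n) = LinearMap.id + (D (n + 1)).comp t := by
      ext x
      have : D (n + 1) (t x) = k (D n x) - x := congrArg Subtype.val (LinearMap.congr_fun ht x)
      simp [this]
    refine ⟨f.comp (LinearMap.lTensor C k), ?_⟩
    change (f.comp (LinearMap.lTensor C k)).comp (d n) = f
    rw [← hD n, LinearMap.comp_assoc, ← LinearMap.lTensor_comp, ht', LinearMap.lTensor_add,
      LinearMap.lTensor_id, LinearMap.lTensor_comp, hD, LinearMap.comp_add, LinearMap.comp_id,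
      ← LinearMap.comp_assoc, hf, LinearMap.zero_comp, add_zero]
  · rintro ⟨g, rfl⟩
    change (g.comp (d n)).comp (d (n + 1)) = 0
    rw [LinearMap.comp_assoc, hdd, LinearMap.comp_zero]

lemma pd_of_vanish (hmu : ∀ (P : Type) [AddCommGroup P] [Module R P], Module.Projective R P →
      Function.Bijective (muMap R C P))
    {M : Type} [AddCommGroup M] [Module R M] {P : ℕ → ModuleCat.{0} R}
    {d : ∀ n : ℕ, (C ⊗[R] ↥(P (n + 1))) →ₗ[R] (C ⊗[R] ↥(P n))}
    {ε : (C ⊗[R] ↥(P 0)) →ₗ[R] M} (h : IsAugProperRes R C M P d ε) (n : ℕ)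
    (hv : ∀ (N : Type) [AddCommGroup N] [Module R N],
      Function.Exact (fun f : (C ⊗[R] ↥(P n)) →ₗ[R] N => f.comp (d n))
      (fun f : (C ⊗[R] ↥(P (n + 1))) →ₗ[R] N => f.comp (d (n + 1)))) :
    PD R (C →ₗ[R] M) n := by
  obtain ⟨D, hD, hs, h0, hex⟩ := proper_exact hmu h
  obtain ⟨hP, hdd, hed, hQ⟩ := h
  refine (PD.res_iff n _ P D (adjE ε) hP hs h0 hex).2 ?_
  let K := LinearMap.range (d (n + 1))
  obtain ⟨g, hg⟩ := (hv (_ ⧸ K) K.mkQ).1 (by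
    change K.mkQ.comp (d (n + 1)) = 0
    exact LinearMap.range_mkQ_comp _)
  have hg : g.comp (d n) = K.mkQ := hg
  let db : (_ ⧸ K) →ₗ[R] (C ⊗[R] ↥(P n)) := K.liftQ (d n) (by
    rintro _ ⟨x, rfl⟩
    exact LinearMap.congr_fun (hdd n) x)
  have hdb : db.comp K.mkQ = d n := Submodule.liftQ_mkQ _ _ _
  obtain ⟨r, hr⟩ := untensor (hmu (P n) (hP n)) (db.comp g)
  refine ⟨r, ?_, ?_⟩
  · ext x
    apply (hmu (P n) (hP n)).1
    ext c
    have h1 : LinearMap.lTensor C (r.comp (D n)) = LinearMap.lTensor C (D n) := by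
      rw [LinearMap.lTensor_comp, hr, hD, LinearMap.comp_assoc, hg, hdb]
    exact LinearMap.congr_fun h1 (c ⊗ₜ x)
  · rintro _ ⟨x, rfl⟩
    have hzero : ∀ {A : Type} [AddCommGroup A] [Module R A] (f : (C ⊗[R] ↥(P n)) →ₗ[R] A),
        f.comp (d n) = 0 → f.comp (LinearMap.lTensor C r) = 0 := by
      intro A _ _ f hf
      have : f.comp db = 0 := by
        apply LinearMap.ext
        intro y
        obtain ⟨y, rfl⟩ := K.mkQ_surjective y
        have := LinearMap.congr_fun hf y
        rw [← hdb] at this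
        exact this
      rw [hr, ← LinearMap.comp_assoc, this, LinearMap.zero_comp]
    cases n with
    | zero =>
      refine (h0 _).1 ?_
      ext c
      exact LinearMap.congr_fun (hzero ε hed) (c ⊗ₜ x)
    | succ n =>
      refine (hex n _).1 ?_
      apply (hmu (P n) (hP n)).1
      ext c
      have := LinearMap.congr_fun (hzero (d n) (hdd n)) (c ⊗ₜ x)
      rw [← hD n] at this
      rw [map_zero]
      exact this
end Main

/-- For `M` admitting an augmented proper `P_C`-projective resolution and `n ≥ 0`, the
following are equivalent: (i) `Ext^{n+1}_{P_C}(M,N) = 0` for all `N`, computed from some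
(equivalently, every) proper resolution; (ii) `Ext^i_{P_C}(M,N) = 0` for all `i ≥ n+1`
and all `N`, computed from some (equivalently, every) proper resolution;
(iii) `P_C-pd(M) ≤ n`. -/
theorem relExt_vanishing_iff_cpdLE
    (R : Type) [CommRing R] (C : Type) [AddCommGroup C] [Module R C]
    (M : Type) [AddCommGroup M] [Module R M] (hC : IsSemidualizing R C) (n : ℕ)
    (hres : ∃ (P : ℕ → ModuleCat.{0} R)
      (d : ∀ k : ℕ, (C ⊗[R] ↥(P (k + 1))) →ₗ[R] (C ⊗[R] ↥(P k)))
      (ε : (C ⊗[R] ↥(P 0)) →ₗ[R] M), IsAugProperRes R C M P d ε) :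
    ((∃ (P : ℕ → ModuleCat.{0} R)
        (d : ∀ k : ℕ, (C ⊗[R] ↥(P (k + 1))) →ₗ[R] (C ⊗[R] ↥(P k)))
        (ε : (C ⊗[R] ↥(P 0)) →ₗ[R] M), IsAugProperRes R C M P d ε ∧
          ∀ (N : Type) [AddCommGroup N] [Module R N],
            Function.Exact (fun f : (C ⊗[R] ↥(P n)) →ₗ[R] N => f.comp (d n))
              (fun f : (C ⊗[R] ↥(P (n + 1))) →ₗ[R] N => f.comp (d (n + 1)))) ↔
      HasBoundedExactCRes R C M n) ∧
    ((∀ (P : ℕ → ModuleCat.{0} R)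
        (d : ∀ k : ℕ, (C ⊗[R] ↥(P (k + 1))) →ₗ[R] (C ⊗[R] ↥(P k)))
        (ε : (C ⊗[R] ↥(P 0)) →ₗ[R] M), IsAugProperRes R C M P d ε →
          ∀ (N : Type) [AddCommGroup N] [Module R N],
            Function.Exact (fun f : (C ⊗[R] ↥(P n)) →ₗ[R] N => f.comp (d n))
              (fun f : (C ⊗[R] ↥(P (n + 1))) →ₗ[R] N => f.comp (d (n + 1)))) ↔
      HasBoundedExactCRes R C M n) ∧
    ((∃ (P : ℕ → ModuleCat.{0} R)
        (d : ∀ k : ℕ, (C ⊗[R] ↥(P (k + 1))) →ₗ[R] (C ⊗[R] ↥(P k)))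
        (ε : (C ⊗[R] ↥(P 0)) →ₗ[R] M), IsAugProperRes R C M P d ε ∧
          ∀ (N : Type) [AddCommGroup N] [Module R N], ∀ j : ℕ, n ≤ j →
            Function.Exact (fun f : (C ⊗[R] ↥(P j)) →ₗ[R] N => f.comp (d j))
              (fun f : (C ⊗[R] ↥(P (j + 1))) →ₗ[R] N => f.comp (d (j + 1)))) ↔
      HasBoundedExactCRes R C M n) ∧
    ((∀ (P : ℕ → ModuleCat.{0} R)
        (d : ∀ k : ℕ, (C ⊗[R] ↥(P (k + 1))) →ₗ[R] (C ⊗[R] ↥(P k)))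
        (ε : (C ⊗[R] ↥(P 0)) →ₗ[R] M), IsAugProperRes R C M P d ε →
          ∀ (N : Type) [AddCommGroup N] [Module R N], ∀ j : ℕ, n ≤ j →
            Function.Exact (fun f : (C ⊗[R] ↥(P j)) →ₗ[R] N => f.comp (d j))
              (fun f : (C ⊗[R] ↥(P (j + 1))) →ₗ[R] N => f.comp (d (j + 1)))) ↔
      HasBoundedExactCRes R C M n) := by
  obtain ⟨⟨F, δ, η, hF, hp, hs, h0, hex⟩, hb, hE⟩ := hC
  have hfin : Module.Finite R C := by
    have := hF 0
    exact Module.Finite.of_surjective η hs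
  have hmu : ∀ (P : Type) [AddCommGroup P] [Module R P], Module.Projective R P →
      Function.Bijective (muMap R C P) := fun P _ _ hP => mu_bij R C hb P
  have hself : EVan R F δ C := evan_self R C F δ η hp hs h0 hex hE
  have hT : ∀ (P : Type) [AddCommGroup P] [Module R P], Module.Projective R P →
      EVan R F δ (C ⊗[R] P) := fun P _ _ hP => hself.tensor hF P
  have hfaith : ∀ (N : Type) [AddCommGroup N] [Module R N], (∀ f : C →ₗ[R] N, f = 0) →
      ∀ x : N, x = 0 := fun N _ _ => faithHom R C hb.1 N
  have h12 := fun h => (pd_of_hb hp hs h0 hex hmu hT n M h).1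
  have h21 := fun h => (hb_of_pd hp hs h0 hex hmu hT hfaith n M h).1
  obtain ⟨P₀, d₀, ε₀, hprop⟩ := hres
  refine ⟨⟨?_, ?_⟩, ⟨?_, ?_⟩, ⟨?_, ?_⟩, ⟨?_, ?_⟩⟩
  · rintro ⟨P, d, ε, h, hv⟩
    exact h21 (pd_of_vanish hmu h n hv)
  · intro h
    exact ⟨P₀, d₀, ε₀, hprop, fun N _ _ => vanish_of_pd hmu hprop n (h12 h) N⟩
  · intro hv
    exact h21 (pd_of_vanish hmu hprop n (hv P₀ d₀ ε₀ hprop))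
  · intro h P d ε hP N _ _
    exact vanish_of_pd hmu hP n (h12 h) N
  · rintro ⟨P, d, ε, h, hv⟩
    exact h21 (pd_of_vanish hmu h n (fun N _ _ => hv N n le_rfl))
  · intro h
    exact ⟨P₀, d₀, ε₀, hprop, fun N _ _ j hj => vanish_of_pd hmu hprop j ((h12 h).mono hj) N⟩
  · intro hv
    exact h21 (pd_of_vanish hmu hprop n (fun N _ _ => hv P₀ d₀ ε₀ hprop N n le_rfl))
  · intro h P d ε hP N _ _ j hj
    exact vanish_of_pd hmu hP j ((h12 h).mono hj) N

end
end

section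
/- Let R be a commutative ring, C a semidualizing R-module, and M, N R-modules, with M admitting an augmented proper P_C-projective resolution X⁺ with truncation X. Then for every i ≥ 0 there is an isomorphism H^i(Hom_R(X,N)) ≅ Ext^i_R(Hom_R(C,M), Hom_R(C,N)); that is, Ext^i_{P_C}(M,N) ≅ Ext^i_R(Hom_R(C,M), Hom_R(C,N)). -/
open TensorProduct CategoryTheory

noncomputable section

lemma muMap_bij_finsupp (R : Type) [CommRing R] (C : Type) [AddCommGroup C] [Module R C]
    [Module.Finite R C]
    (h : Function.Bijective (fun r : R => (r • LinearMap.id : C →ₗ[R] C))) (I : Type) :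
    Function.Bijective (muMap R C (I →₀ R)) := by
  classical
  let e := TensorProduct.finsuppScalarRight R R C I
  have he : ∀ (c : C) (p : I →₀ R) (i : I), e (c ⊗ₜ[R] p) i = p i • c := fun c p i =>
    TensorProduct.finsuppScalarRight_apply_tmul_apply c p i
  constructor
  · rw [injective_iff_map_eq_zero]
    intro x hx
    ext i
    apply h.1
    ext c
    have h1 : c ⊗ₜ[R] x = 0 := LinearMap.congr_fun hx c
    have h2 := he c x i
    rw [h1] at h2
    simpa using h2.symm
  · intro φ
    let ψ : C →ₗ[R] (I →₀ C) := e.toLinearMap ∘ₗ φ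
    choose r hr using fun i : I => h.2 (Finsupp.lapply i ∘ₗ ψ)
    have hr' : ∀ i c, r i • c = ψ c i := fun i c => LinearMap.congr_fun (hr i) c
    obtain ⟨S, hS⟩ := (Module.finite_def (R := R) (M := C)).1 inferInstance
    have hsupp : ∀ i, r i ≠ 0 → i ∈ S.biUnion (fun c => (ψ c).support) := by
      intro i hi
      by_contra hn
      apply hi
      apply h.1
      apply LinearMap.ext_on hS
      intro c hc
      have : i ∉ (ψ c).support := fun hm => hn (Finset.mem_biUnion.2 ⟨c, hc, hm⟩)
      rw [Finsupp.notMem_support_iff] at this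
      simp [hr', this]
    refine ⟨Finsupp.onFinset _ r hsupp, ?_⟩
    ext c
    apply e.injective
    ext i
    refine (he c _ i).trans ?_
    exact hr' i c

lemma muMap_bij (R : Type) [CommRing R] (C : Type) [AddCommGroup C] [Module R C]
    [Module.Finite R C]
    (h : Function.Bijective (fun r : R => (r • LinearMap.id : C →ₗ[R] C)))
    (P : Type) [AddCommGroup P] [Module R P] [Module.Projective R P] :
    Function.Bijective (muMap R C P) := by
  obtain ⟨s, hs⟩ := Module.projective_def'.1 (inferInstance : Module.Projective R P)
  have hF := muMap_bij_finsupp R C h P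
  set π := Finsupp.linearCombination R (id : P → P)
  have hs' : ∀ p, π (s p) = p := fun p => LinearMap.congr_fun hs p
  constructor
  · rw [injective_iff_map_eq_zero]
    intro x hx
    have : s x = 0 := by
      apply hF.1
      rw [map_zero]
      ext c
      have h1 : c ⊗ₜ[R] x = 0 := LinearMap.congr_fun hx c
      have h2 := congrArg (LinearMap.lTensor C s) h1
      rw [LinearMap.lTensor_tmul, map_zero] at h2
      exact h2
    rw [← hs' x, this, map_zero]
  · intro φ
    obtain ⟨x, hx⟩ := hF.2 (LinearMap.lTensor C s ∘ₗ φ)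
    refine ⟨π x, ?_⟩
    ext c
    have h1 : c ⊗ₜ[R] x = LinearMap.lTensor C s (φ c) := LinearMap.congr_fun hx c
    have h2 := congrArg (LinearMap.lTensor C π) h1
    rw [← LinearMap.comp_apply, ← LinearMap.lTensor_comp, hs] at h2
    rw [LinearMap.lTensor_tmul, LinearMap.lTensor_id] at h2
    exact h2

/-- The projective resolution built from an explicit exact sequence. -/
def mkProjRes {R : Type} [CommRing R] (A : ModuleCat.{0} R)
    (P : ℕ → ModuleCat.{0} R) (f : ∀ n, P (n + 1) ⟶ P n) (η : P 0 ⟶ A)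
    (hP : ∀ n, Projective (P n)) (hη : Function.Surjective η)
    (w0 : f 0 ≫ η = 0) (w : ∀ n, f (n + 1) ≫ f n = 0)
    (h0 : Function.Exact (f 0) η) (h : ∀ n, Function.Exact (f (n + 1)) (f n)) :
    ProjectiveResolution A where
  complex := ChainComplex.of P f w
  projective := hP
  π := (ChainComplex.toSingle₀Equiv _ _).symm ⟨η, by
    rw [show (ChainComplex.of P f w).d 1 0 = f 0 from ChainComplex.of_d P f 0]; exact w0⟩
  quasiIso := ⟨fun n => by
    cases n
    · rw [ChainComplex.quasiIsoAt₀_iff, ShortComplex.quasiIso_iff_of_zeros']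
      · refine (ShortComplex.exact_and_epi_g_iff_of_iso ?_).2
          (⟨ModuleCat.shortComplex_exact (ShortComplex.mk (f 0) η w0) h0,
            (ModuleCat.epi_iff_surjective _).2 hη⟩)
        exact ShortComplex.isoMk (Iso.refl _) (Iso.refl _) (Iso.refl _)
          (by
            refine (Category.id_comp _).trans (Eq.trans ?_ (Category.comp_id _).symm)
            exact (ChainComplex.of_d P f 0).symm) (by
            refine (Category.id_comp _).trans (Eq.trans ?_ (Category.comp_id _).symm)
            exact (ChainComplex.toSingle₀Equiv_symm_apply_f_zero
              (C := ChainComplex.of P f w) (X := A) η _).symm)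
      all_goals rfl
    · rename_i n
      rw [quasiIsoAt_iff_exactAt']
      · rw [HomologicalComplex.exactAt_iff' _ (n + 1 + 1) (n + 1) n (by simp) (by simp)]
        refine ModuleCat.shortComplex_exact _ ?_
        have e1 : (ChainComplex.of P f w).d (n + 1 + 1) (n + 1) = f (n + 1) :=
          ChainComplex.of_d P f (n + 1)
        have e2 : (ChainComplex.of P f w).d (n + 1) n = f n := ChainComplex.of_d P f n
        change Function.Exact ((ChainComplex.of P f w).d (n + 1 + 1) (n + 1))
          ((ChainComplex.of P f w).d (n + 1) n)
        rw [e1, e2]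
        exact h n
      · apply ChainComplex.exactAt_succ_single_obj⟩

lemma homology_equiv {R : Type} [CommRing R] (S : ShortComplex (ModuleCat.{0} R))
    {A₁ A₂ A₃ : Type} [AddCommGroup A₁] [Module R A₁] [AddCommGroup A₂] [Module R A₂]
    [AddCommGroup A₃] [Module R A₃] (a : A₁ →ₗ[R] A₂) (b : A₂ →ₗ[R] A₃)
    (e₁ : A₁ ≃ₗ[R] S.X₁) (e₂ : A₂ ≃ₗ[R] S.X₂) (e₃ : A₃ ≃ₗ[R] S.X₃)
    (ha : ∀ x, e₂ (a x) = S.f (e₁ x)) (hb : ∀ x, e₃ (b x) = S.g (e₂ x)) :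
    Nonempty ((↥(LinearMap.ker b) ⧸ (Submodule.comap (LinearMap.ker b).subtype
      (LinearMap.range a))) ≃ₗ[R] S.homology) := by
  have hk : (LinearMap.ker b).map e₂.toLinearMap = LinearMap.ker S.g.hom := by
    ext y
    constructor
    · rintro ⟨x, hx, rfl⟩
      have := hb x
      rw [LinearMap.mem_ker.1 hx, map_zero] at this
      exact this.symm
    · intro hy
      refine ⟨e₂.symm y, ?_, by simp⟩
      have := hb (e₂.symm y)
      rw [LinearEquiv.apply_symm_apply] at this
      change b _ = 0
      apply e₃.injective
      rw [this, map_zero]; exact hy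
  let ek : LinearMap.ker b ≃ₗ[R] LinearMap.ker S.g.hom := e₂.ofSubmodules _ _ hk
  refine ⟨(Submodule.Quotient.equiv _ (LinearMap.range S.moduleCatToCycles) ek ?_).trans
    S.moduleCatHomologyIso.toLinearEquiv.symm⟩
  ext y
  constructor
  · rintro ⟨x, ⟨z, hz⟩, rfl⟩
    refine ⟨e₁ z, ?_⟩
    apply Subtype.ext
    exact (ha z).symm.trans (congrArg e₂ hz)
  · rintro ⟨x, rfl⟩
    refine ⟨ek.symm (S.moduleCatToCycles x), ⟨e₁.symm x, ?_⟩, by simp⟩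
    apply e₂.injective
    rw [ha, LinearEquiv.apply_symm_apply]
    exact congrArg Subtype.val (ek.apply_symm_apply (S.moduleCatToCycles x)).symm

lemma homology_equiv₀ {R : Type} [CommRing R] (S : ShortComplex (ModuleCat.{0} R))
    {A₂ A₃ : Type} [AddCommGroup A₂] [Module R A₂]
    [AddCommGroup A₃] [Module R A₃] (b : A₂ →ₗ[R] A₃)
    (e₂ : A₂ ≃ₗ[R] S.X₂) (e₃ : A₃ ≃ₗ[R] S.X₃)
    (ha : S.f = 0) (hb : ∀ x, e₃ (b x) = S.g (e₂ x)) :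
    Nonempty (↥(LinearMap.ker b) ≃ₗ[R] S.homology) := by
  obtain ⟨e⟩ := homology_equiv S (0 : S.X₁ →ₗ[R] A₂) b (LinearEquiv.refl R _) e₂ e₃
    (fun x => by simp [ha]) hb
  refine ⟨(Submodule.quotEquivOfEqBot _ ?_).symm.trans e⟩
  rw [LinearMap.range_zero]
  exact LinearMap.ker_eq_bot.2 (Subtype.val_injective)

/-- Tensor-hom adjunction in the form needed. -/
def adjEquiv (R : Type) [CommRing R] (C P N : Type) [AddCommGroup C] [Module R C]
    [AddCommGroup P] [Module R P] [AddCommGroup N] [Module R N] :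
    ((C ⊗[R] P) →ₗ[R] N) ≃ₗ[R] (ModuleCat.of R P ⟶ ModuleCat.of R (C →ₗ[R] N)) :=
  ((TensorProduct.lift.equiv (RingHom.id R) C P N).symm.trans LinearMap.lflip).trans
    (ModuleCat.homLinearEquiv (S := R) (M := ModuleCat.of R P)
      (N := ModuleCat.of R (C →ₗ[R] N))).symm

/-- For an augmented proper `P_C`-projective resolution `X⁺` of `M` with truncation `X`,
the cohomology of `Hom_R(X,N)` is isomorphic to
`Ext^i_R(Hom_R(C,M), Hom_R(C,N))`; that is,
`Ext^i_{P_C}(M,N) ≅ Ext^i_R(Hom_R(C,M), Hom_R(C,N))` for all `i ≥ 0`. -/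
theorem relExt_iso_absExt_hom
    (R : Type) [CommRing R] (C : Type) [AddCommGroup C] [Module R C]
    (M : Type) [AddCommGroup M] [Module R M]
    (N : Type) [AddCommGroup N] [Module R N] (hC : IsSemidualizing R C)
    (P : ℕ → ModuleCat.{0} R)
    (d : ∀ k : ℕ, (C ⊗[R] ↥(P (k + 1))) →ₗ[R] (C ⊗[R] ↥(P k)))
    (ε : (C ⊗[R] ↥(P 0)) →ₗ[R] M)
    (hX : IsAugProperRes R C M P d ε) :
    Nonempty (↥(LinearMap.ker (LinearMap.lcomp R N (d 0))) ≃ₗ[R]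
      ↥(extMod R (C →ₗ[R] M) (C →ₗ[R] N) 0)) ∧
    ∀ i : ℕ, Nonempty (
      (↥(LinearMap.ker (LinearMap.lcomp R N (d (i + 1)))) ⧸
        (Submodule.comap (LinearMap.ker (LinearMap.lcomp R N (d (i + 1)))).subtype
          (LinearMap.range (LinearMap.lcomp R N (d i))))) ≃ₗ[R]
      ↥(extMod R (C →ₗ[R] M) (C →ₗ[R] N) (i + 1))) := by
  obtain ⟨⟨Q, _, q, hQ, -, hq, -⟩, hCC, -⟩ := hC
  have := hQ 0
  have : Module.Finite R C := Module.Finite.of_surjective q hq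
  obtain ⟨hP, hdd, hεd, hex⟩ := hX
  have hμ : ∀ n, Function.Bijective (muMap R C (P n)) := fun n =>
    have := hP n
    muMap_bij R C hCC (P n)
  let μ : ∀ n, P n ≃ₗ[R] (C →ₗ[R] (C ⊗[R] P n)) := fun n => LinearEquiv.ofBijective _ (hμ n)
  let f : ∀ n, P (n + 1) →ₗ[R] P n := fun n =>
    (μ n).symm.toLinearMap ∘ₗ (d n).compRight R ∘ₗ (μ (n + 1)).toLinearMap
  let η : P 0 →ₗ[R] (C →ₗ[R] M) := ε.compRight R ∘ₗ (μ 0).toLinearMap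
  have hf : ∀ n x, μ n (f n x) = (d n).comp (μ (n + 1) x) := fun n x => by
    simp [f, LinearMap.compRight]
  have hη : ∀ x, η x = ε.comp (μ 0 x) := fun x => rfl
  have hfc : ∀ n c x, c ⊗ₜ[R] f n x = d n (c ⊗ₜ[R] x) := fun n c x =>
    LinearMap.congr_fun (hf n x) c
  -- exactness of `Hom(C, X⁺)`
  obtain ⟨s0, s1, s2⟩ := hex R inferInstance
  let ρ := TensorProduct.rid R C
  have key : ∀ {A B D : Type} [AddCommGroup A] [Module R A] [AddCommGroup B] [Module R B]
      [AddCommGroup D] [Module R D] (u : A →ₗ[R] B) (v : B →ₗ[R] D),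
      Function.Exact (fun g : (C ⊗[R] R) →ₗ[R] A => u.comp g) (fun g => v.comp g) →
      Function.Exact (fun g : C →ₗ[R] A => u.comp g) (fun g : C →ₗ[R] B => v.comp g) := by
    intro A B D _ _ _ _ _ _ u v h g
    constructor
    · intro hg
      have h1 := (h (g.comp ρ.toLinearMap)).1 (by
        change v.comp g = 0 at hg
        change v.comp (g.comp ρ.toLinearMap) = 0
        rw [← LinearMap.comp_assoc, hg, LinearMap.zero_comp])
      obtain ⟨k, hk⟩ := h1
      refine ⟨k.comp ρ.symm.toLinearMap, ?_⟩
      ext c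
      have := LinearMap.congr_fun hk (ρ.symm c)
      simpa using this
    · rintro ⟨k, rfl⟩
      have h1 := (h (u.comp (k.comp ρ.toLinearMap))).2 ⟨_, rfl⟩
      ext c
      have := LinearMap.congr_fun h1 (ρ.symm c)
      simpa using this
  have t0 : Function.Surjective η := by
    intro g
    obtain ⟨k, hk⟩ := s0 (g.comp ρ.toLinearMap)
    refine ⟨(μ 0).symm (k.comp ρ.symm.toLinearMap), ?_⟩
    rw [hη, LinearEquiv.apply_symm_apply]
    ext c
    have := LinearMap.congr_fun hk (ρ.symm c)
    simpa using this
  have t1 : Function.Exact (f 0) η := by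
    intro x
    rw [hη]
    refine (key _ _ s1 (μ 0 x)).trans ?_
    constructor
    · rintro ⟨k, hk⟩
      refine ⟨(μ 1).symm k, (μ 0).injective ?_⟩
      rw [hf, LinearEquiv.apply_symm_apply]; exact hk
    · rintro ⟨y, rfl⟩
      exact ⟨μ 1 y, (hf 0 y).symm⟩
  have t2 : ∀ n, Function.Exact (f (n + 1)) (f n) := by
    intro n x
    rw [← (μ n).map_eq_zero_iff, hf]
    refine (key _ _ (s2 n) (μ (n + 1) x)).trans ?_
    constructor
    · rintro ⟨k, hk⟩
      refine ⟨(μ (n + 2)).symm k, (μ (n + 1)).injective ?_⟩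
      rw [hf, LinearEquiv.apply_symm_apply]; exact hk
    · rintro ⟨y, rfl⟩
      exact ⟨μ (n + 2) y, (hf (n + 1) y).symm⟩
  let X := mkProjRes (ModuleCat.of R (C →ₗ[R] M)) P (fun n => ModuleCat.ofHom (f n))
    (ModuleCat.ofHom η) (fun n => by
      have := hP n
      exact ModuleCat.projective_of_categoryTheory_projective _) t0
    (ModuleCat.hom_ext t1.linearMap_comp_eq_zero)
    (fun n => ModuleCat.hom_ext (t2 n).linearMap_comp_eq_zero) t1 t2
  let Y := X.complex.linearYonedaObj R (ModuleCat.of R (C →ₗ[R] N))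
  let e : ∀ n, ((C ⊗[R] P n) →ₗ[R] N) ≃ₗ[R] Y.X n := fun n => adjEquiv R C (P n) N
  have he : ∀ n g, e (n + 1) (LinearMap.lcomp R N (d n) g) = Y.d n (n + 1) (e n g) := by
    intro n g
    have e1 : X.complex.d (n + 1) n = ModuleCat.ofHom (f n) :=
      ChainComplex.of_d P (fun n => ModuleCat.ofHom (f n)) n
    change adjEquiv R C (P (n + 1)) N (LinearMap.lcomp R N (d n) g) =
      X.complex.d (n + 1) n ≫ adjEquiv R C (P n) N g
    rw [e1]
    refine ModuleCat.hom_ext (LinearMap.ext fun x => LinearMap.ext fun c => ?_)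
    change g (d n (c ⊗ₜ[R] x)) = g (c ⊗ₜ[R] f n x)
    rw [hfc]
  constructor
  · obtain ⟨h⟩ := homology_equiv₀ (Y.sc' 0 0 1) (LinearMap.lcomp R N (d 0)) (e 0) (e 1)
      (Y.shape _ _ (by simp)) (he 0)
    exact ⟨h.trans ((X.isoExt 0 _ ≪≫ Y.homologyIsoSc' 0 0 1 (by simp) (by simp)).toLinearEquiv.symm)⟩
  · intro i
    obtain ⟨h⟩ := homology_equiv (Y.sc' i (i + 1) (i + 2)) (LinearMap.lcomp R N (d i))
      (LinearMap.lcomp R N (d (i + 1))) (e i) (e (i + 1)) (e (i + 2)) (he i) (he (i + 1))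
    exact ⟨h.trans ((X.isoExt (i + 1) _ ≪≫
      Y.homologyIsoSc' i (i + 1) (i + 2) (by simp) (by simp)).toLinearEquiv.symm)⟩

end
end
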